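/- arXiv:1801.07034 — 3 statements merged into one kernel-verified Lean document; each statement's English description precedes it below -/
import Mathlib

section
/- For every integer n ≥ 0 the sequence S^{n−a}U ⊗ Λ^a G_a ⊗ G_{a−1} →^{d_a} S^{n−a+1}U ⊗ Λ^{a−1} G_a ⊗ G_{a−2} →^{d_{a−1}} ⋯ →^{d_3} S^{n−2}U ⊗ Λ² G_a ⊗ G_1 →^{d_2} S^n U →^{π} W_{na} → 0 is exact; that is, π is surjective, ker π = im d_2, and ker d_q = im d_{q+1} for each 2 ≤ q ≤ a−1. -/
open MvPolynomial
open scoped TensorProduct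

set_option maxHeartbeats 1600000
set_option synthInstance.maxHeartbeats 400000
set_option maxSynthPendingDepth 3

noncomputable section

/-- `SU k a m` is the space `S^m U` of homogeneous polynomials of degree `m` in
`k[x_0,…,x_a]`, interpreted as `0` for `m < 0`. -/
def SU (k : Type*) [Field k] (a : ℕ) (m : ℤ) : Submodule k (MvPolynomial (Fin (a + 1)) k) :=
  if 0 ≤ m then MvPolynomial.homogeneousSubmodule (Fin (a + 1)) k m.toNat else ⊥

theorem xMul_mem {k : Type*} [Field k] {a : ℕ} (i : Fin (a + 1)) {m m' : ℤ}
    {p : MvPolynomial (Fin (a + 1)) k} (hp : p ∈ SU k a m) (h : m' = m + 1) :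
    MvPolynomial.X i * p ∈ SU k a m' := by
  subst h
  unfold SU at hp ⊢
  by_cases hm : 0 ≤ m
  · rw [if_pos hm, MvPolynomial.mem_homogeneousSubmodule] at hp
    rw [if_pos (by omega), MvPolynomial.mem_homogeneousSubmodule]
    have h2 := (MvPolynomial.isHomogeneous_X k i).mul hp
    rwa [show 1 + m.toNat = (m + 1).toNat by omega] at h2
  · rw [if_neg hm, Submodule.mem_bot] at hp
    subst hp
    rw [mul_zero]
    exact Submodule.zero_mem _

/-- Multiplication by `x_i` maps `S^{n-q} U` into `S^{n-(q-1)} U` (for `1 ≤ q`). -/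
theorem xMulSU {k : Type*} [Field k] {a : ℕ} (i : Fin (a + 1)) {n : ℤ} {q : ℕ} (hq : 1 ≤ q)
    {p : MvPolynomial (Fin (a + 1)) k} (hp : p ∈ SU k a (n - q)) :
    MvPolynomial.X i * p ∈ SU k a (n - (q - 1 : ℕ)) :=
  xMul_mem i hp (by omega)

/-- `(x_{i_1} x_{i_2} - x_{i_3} x_{i_4}) · m` lies in `S^n U` when `m ∈ S^{n-2} U`. -/
theorem quadMulSU {k : Type*} [Field k] {a : ℕ} (i1 i2 i3 i4 : Fin (a + 1)) {n : ℕ}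
    {p : MvPolynomial (Fin (a + 1)) k} (hp : p ∈ SU k a ((n : ℤ) - 2)) :
    (X i1 * X i2 - X i3 * X i4) * p ∈ SU k a (n : ℤ) := by
  rw [sub_mul]
  by_cases h2 : (2 : ℤ) ≤ (n : ℤ)
  · unfold SU at hp ⊢
    rw [if_pos (by omega), MvPolynomial.mem_homogeneousSubmodule] at hp
    rw [if_pos (by omega)]
    refine Submodule.sub_mem _ ?_ ?_
    · rw [MvPolynomial.mem_homogeneousSubmodule, mul_assoc]
      have hh := (MvPolynomial.isHomogeneous_X k i1).mul
        ((MvPolynomial.isHomogeneous_X k i2).mul hp)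
      rwa [show 1 + (1 + ((n : ℤ) - 2).toNat) = (n : ℤ).toNat by omega] at hh
    · rw [MvPolynomial.mem_homogeneousSubmodule, mul_assoc]
      have hh := (MvPolynomial.isHomogeneous_X k i3).mul
        ((MvPolynomial.isHomogeneous_X k i4).mul hp)
      rwa [show 1 + (1 + ((n : ℤ) - 2).toNat) = (n : ℤ).toNat by omega] at hh
  · unfold SU at hp
    rw [if_neg (by omega), Submodule.mem_bot] at hp
    subst hp
    simp

theorem monMemSU {k : Type*} [Field k] {a n : ℕ} {d : Fin (a + 1) →₀ ℕ}
    (hd : d.degree = n) : (MvPolynomial.monomial d (1 : k)) ∈ SU k a (n : ℤ) := by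
  unfold SU
  rw [if_pos (by positivity), MvPolynomial.mem_homogeneousSubmodule]
  exact MvPolynomial.isHomogeneous_monomial _ (by omega)

/-- The basis vector `w_s` of the vector space `W` with basis `w_0, …, w_M`;
zero if `s` is out of range. -/
def wW (k : Type*) [Field k] (M s : ℕ) : Fin (M + 1) → k :=
  if h : s ≤ M then Pi.single (⟨s, by omega⟩ : Fin (M + 1)) 1 else 0

/-- The basis vector `g_h` of a vector space `G_m` with basis `g_1, …, g_m`;
by convention `g_h = 0` when `h` is out of range. -/
def gG (k : Type*) [Field k] (m : ℕ) (h : ℤ) : Fin m → k :=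
  if H : 1 ≤ h ∧ h ≤ m then Pi.single (⟨(h - 1).toNat, by omega⟩ : Fin m) 1 else 0

/-- The increasing enumeration `Fin (m−1) → Fin m` of `{0,…,m−1} \ {l}`. -/
def skipAt {m : ℕ} (l : Fin m) (t : Fin (m - 1)) : Fin m :=
  ⟨if (t : ℕ) < (l : ℕ) then (t : ℕ) else (t : ℕ) + 1, by
    have := t.2; have := l.2; split <;> omega⟩

/-- The wedge product of a family of vectors, as an element of the `n`-th exterior power. -/
def wedge (k : Type*) [Field k] {M : Type*} [AddCommGroup M] [Module k M] (n : ℕ)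
    (v : Fin n → M) : ⋀[k]^n M :=
  ⟨ExteriorAlgebra.ιMulti k n v, ExteriorAlgebra.ιMulti_range k n (Set.mem_range_self v)⟩

section Triangular

variable {k A B C ι κ R : Type*} [Field k] [AddCommGroup A] [Module k A] [AddCommGroup B]
  [Module k B] [AddCommGroup C] [Module k C]

/-- If every basis vector indexed by `T` is, up to a unit and modulo vectors indexed by `S` or of
smaller rank, in the range of `f`, then the vectors indexed by `S` span modulo the range of `f`. -/
theorem range_sup_span_eq_top [Preorder R] [WellFoundedLT R] (f : A →ₗ[k] B) (b : ι → B)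
    (S T : Set ι) (rk : ι → R) (hspan : Submodule.span k (b '' (S ∪ T)) = ⊤)
    (hT : ∀ j ∈ T, ∃ x : A, ∃ c : k, c ≠ 0 ∧
      f x - c • b j ∈ Submodule.span k (b '' (S ∪ {i ∈ T | rk i < rk j}))) :
    LinearMap.range f ⊔ Submodule.span k (b '' S) = ⊤ := by
  have hS : ∀ i ∈ S, b i ∈ LinearMap.range f ⊔ Submodule.span k (b '' S) := fun i hi =>
    Submodule.mem_sup_right (Submodule.subset_span ⟨i, hi, rfl⟩)
  have key : ∀ r : R, ∀ j ∈ T, rk j = r →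
      b j ∈ LinearMap.range f ⊔ Submodule.span k (b '' S) := by
    intro r
    induction r using WellFoundedLT.induction with
    | ind r ih =>
      rintro j hj rfl
      obtain ⟨x, c, hc, hx⟩ := hT j hj
      have hle : Submodule.span k (b '' (S ∪ {i ∈ T | rk i < rk j})) ≤
          LinearMap.range f ⊔ Submodule.span k (b '' S) := by
        rw [Submodule.span_le]
        rintro _ ⟨i, hi | hi, rfl⟩
        · exact hS i hi
        · exact ih _ hi.2 i hi.1 rfl
      have h2 : c • b j ∈ LinearMap.range f ⊔ Submodule.span k (b '' S) := by
        have := Submodule.sub_mem _ (Submodule.mem_sup_left (LinearMap.mem_range_self f x)) (hle hx)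
        simpa using this
      exact (Submodule.smul_mem_iff _ hc).1 h2
  rw [eq_top_iff, ← hspan, Submodule.span_le]
  rintro _ ⟨i, hi | hi, rfl⟩
  · exact hS i hi
  · exact key _ i hi rfl

/-- A linear map which is unitriangular, with respect to an injection `p` of index sets, on a
family of vectors is injective on its span. -/
theorem eq_zero_of_mem_span_of_triangular [LinearOrder R] (g : B →ₗ[k] C) (b : ι → B) (c : κ → C)
    (S : Set ι) (P T : Set κ) (φ : κ → C →ₗ[k] k) (p : ι → κ) (rk : κ → R)
    (hφ₁ : ∀ i ∈ P, φ i (c i) = 1) (hφ₀ : ∀ i ∈ P, ∀ j ∈ P, i ≠ j → φ i (c j) = 0)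
    (hT : T ⊆ P) (hp : Set.MapsTo p S T) (hinj : Set.InjOn p S)
    (htri : ∀ i ∈ S, ∃ u : k, u ≠ 0 ∧
      g (b i) - u • c (p i) ∈ Submodule.span k (c '' ((P \ T) ∪ {j ∈ T | rk j < rk (p i)})))
    {v : B} (hv : v ∈ Submodule.span k (b '' S)) (hgv : g v = 0) : v = 0 := by
  classical
  rw [Finsupp.mem_span_image_iff_linearCombination] at hv
  obtain ⟨l, hl, rfl⟩ := hv
  rw [Finsupp.mem_supported] at hl
  by_contra hne
  have hl0 : l.support.Nonempty := by
    rw [Finsupp.support_nonempty_iff]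
    rintro rfl
    simp at hne
  obtain ⟨i, hi, hmax⟩ := l.support.exists_max_image (fun i => rk (p i)) hl0
  have hiS : i ∈ S := hl hi
  have hval : ∀ i' ∈ l.support, ∃ u : k, u ≠ 0 ∧
      φ (p i) (g (b i')) = u * φ (p i) (c (p i')) := by
    intro i' hi'
    obtain ⟨u, hu, hmem⟩ := htri i' (hl hi')
    refine ⟨u, hu, ?_⟩
    have hle : Submodule.span k (c '' ((P \ T) ∪ {j ∈ T | rk j < rk (p i')})) ≤
        LinearMap.ker (φ (p i)) := by
      rw [Submodule.span_le]
      rintro _ ⟨j, hj | hj, rfl⟩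
      · refine hφ₀ _ (hT (hp hiS)) _ hj.1 ?_
        rintro rfl
        exact hj.2 (hp hiS)
      · refine hφ₀ _ (hT (hp hiS)) _ (hT hj.1) ?_
        rintro rfl
        exact absurd (hmax i' hi') (not_le.2 hj.2)
    have h0 := hle hmem
    rw [LinearMap.mem_ker, map_sub, map_smul, smul_eq_mul, sub_eq_zero] at h0
    exact h0
  have hsum : φ (p i) (g (Finsupp.linearCombination k b l)) = 0 := by rw [hgv, map_zero]
  rw [Finsupp.linearCombination_apply, Finsupp.sum, map_sum, map_sum,
    Finset.sum_eq_single_of_mem i hi] at hsum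
  · obtain ⟨u, hu, hu'⟩ := hval i hi
    rw [map_smul, map_smul, hu', hφ₁ _ (hT (hp hiS)), mul_one, smul_eq_mul] at hsum
    exact (mul_ne_zero (Finsupp.mem_support_iff.1 hi) hu) hsum
  · intro i' hi' hne'
    obtain ⟨u, hu, hu'⟩ := hval i' hi'
    have hpne : p i ≠ p i' := fun h => hne' (hinj (hl hi') hiS h.symm)
    rw [map_smul, map_smul, hu', hφ₀ _ (hT (hp hiS)) _ (hT (hp (hl hi'))) hpne]
    simp

/-- A complex `A → B → C` is exact at `B` as soon as `B` is spanned by vectors of the range of `f`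
and of a subspace on which `g` is injective. -/
theorem ker_eq_range_of_sup_eq_top (f : A →ₗ[k] B) (g : B →ₗ[k] C) (hgf : g ∘ₗ f = 0)
    (N : Submodule k B) (htop : LinearMap.range f ⊔ N = ⊤)
    (hinj : ∀ v ∈ N, g v = 0 → v = 0) : LinearMap.ker g = LinearMap.range f := by
  apply le_antisymm
  · intro v hv
    obtain ⟨_, ⟨x, rfl⟩, y, hy, rfl⟩ := Submodule.mem_sup.1 (htop ▸ Submodule.mem_top : v ∈ _)
    have hgx : g (f x) = 0 := LinearMap.congr_fun hgf x
    rw [LinearMap.mem_ker, map_add, hgx, zero_add] at hv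
    rw [hinj y hy hv, add_zero]
    exact LinearMap.mem_range_self f x
  · exact LinearMap.range_le_ker_iff.2 hgf

end Triangular

section Basis

variable (k : Type*) [Field k] (a n : ℕ)

/-- The term `S^{n-q}U ⊗ Λ^q G_a ⊗ G_{q-1}` of the complex. -/
abbrev ENTerm (q : ℕ) : Type _ :=
  (SU k a ((n : ℤ) - q) ⊗[k] ⋀[k]^q (Fin a → k)) ⊗[k] (Fin (q - 1) → k)

variable {a} in
/-- The monomial with exponent `μ` as an element of `S^m U`; zero if its degree is not `m`. -/
def monSU (m : ℤ) (μ : Fin (a + 1) →₀ ℕ) : SU k a m :=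
  if h : (μ.degree : ℤ) = m then ⟨monomial μ 1, h ▸ monMemSU rfl⟩ else 0

/-- Multiplication by `x_i` from `S^{n-(q+1)}U` to `S^{n-q}U`. -/
def xSU {k : Type*} [Field k] {a n q : ℕ} (i : Fin (a + 1)) (m : SU k a ((n : ℤ) - (q + 1 : ℕ))) :
    SU k a ((n : ℤ) - q) :=
  ⟨X i * (m : MvPolynomial (Fin (a + 1)) k), xMulSU i (Nat.le_add_left 1 q) m.2⟩

/-- Combinatorial indices `(μ, J, h)` of the vectors `x^μ ⊗ g_{J} ⊗ g_h`. -/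
abbrev ENIdx (q : ℕ) : Type := (Fin (a + 1) →₀ ℕ) × (Fin q → Fin a) × ℕ

variable {a} in
/-- The vector `x^μ ⊗ g_{J} ⊗ g_h`. -/
def enVec (q : ℕ) (i : ENIdx a q) : ENTerm k a n q :=
  (monSU k ((n : ℤ) - q) i.1 ⊗ₜ[k] wedge k q (fun t => Pi.single (i.2.1 t) 1)) ⊗ₜ[k]
    gG k (q - 1) (i.2.2 : ℤ)

variable {a} in
/-- The indices of the standard basis of `S^{n-q}U ⊗ Λ^q G_a ⊗ G_{q-1}`. -/
def enValid (q : ℕ) : Set (ENIdx a q) :=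
  {i | i.1.degree + q = n ∧ StrictMono i.2.1 ∧ 1 ≤ i.2.2 ∧ i.2.2 + 1 ≤ q}

variable {k n}

theorem coe_monSU {m : ℤ} {μ : Fin (a + 1) →₀ ℕ} (h : (μ.degree : ℤ) = m) :
    (monSU k m μ : MvPolynomial (Fin (a + 1)) k) = monomial μ 1 := by
  simp [monSU, h]

theorem span_monSU (m : ℤ) :
    Submodule.span k (monSU k m '' {μ : Fin (a + 1) →₀ ℕ | (μ.degree : ℤ) = m}) = ⊤ := by
  rw [eq_top_iff]
  rintro ⟨p, hp⟩ -
  have hdeg : ∀ μ ∈ p.support, (μ.degree : ℤ) = m := by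
    intro μ hμ
    unfold SU at hp
    split_ifs at hp with hm
    · have := (MvPolynomial.mem_homogeneousSubmodule _ _).1 hp (MvPolynomial.mem_support_iff.1 hμ)
      have h2 : μ.degree = m.toNat := by rw [Finsupp.degree_eq_weight_one]; exact this
      omega
    · rw [Submodule.mem_bot] at hp
      simp [hp] at hμ
  have hsum : (⟨p, hp⟩ : SU k a m) = ∑ μ ∈ p.support, p.coeff μ • monSU k m μ := by
    apply Subtype.ext
    rw [Submodule.coe_sum]
    conv_lhs => rw [show ((⟨p, hp⟩ : SU k a m) : MvPolynomial (Fin (a + 1)) k) = p from rfl,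
      p.as_sum]
    refine Finset.sum_congr rfl fun μ hμ => ?_
    rw [Submodule.coe_smul, coe_monSU a (hdeg μ hμ), smul_monomial, smul_eq_mul, mul_one]
  rw [hsum]
  exact Submodule.sum_mem _ fun μ hμ =>
    Submodule.smul_mem _ _ (Submodule.subset_span ⟨μ, hdeg μ hμ, rfl⟩)

theorem wedge_eq_ιMulti (q : ℕ) (v : Fin q → Fin a → k) :
    wedge k q v = exteriorPower.ιMulti k q v := rfl

theorem span_wedge (q : ℕ) :
    Submodule.span k ((fun J : Fin q → Fin a => wedge k q fun t => (Pi.single (J t) 1 : Fin a → k)) ''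
      {J | StrictMono J}) = ⊤ := by
  rw [eq_top_iff, ← exteriorPower.ιMulti_family_span_of_span k (Pi.basisFun k (Fin a)).span_eq,
    Submodule.span_le]
  rintro _ ⟨s, rfl⟩
  refine Submodule.subset_span ⟨Set.powersetCard.ofFinEmbEquiv.symm s,
    (Set.powersetCard.ofFinEmbEquiv.symm s).strictMono, ?_⟩
  simp only [exteriorPower.ιMulti_family, wedge_eq_ιMulti]
  congr 1
  ext t
  simp

theorem span_gG (m : ℕ) :
    Submodule.span k ((fun h : ℕ => gG k m h) '' {h | 1 ≤ h ∧ h ≤ m}) = ⊤ := by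
  rw [eq_top_iff, ← (Pi.basisFun k (Fin m)).span_eq, Submodule.span_le]
  rintro _ ⟨s, rfl⟩
  refine Submodule.subset_span ⟨s + 1, ⟨by omega, by omega⟩, ?_⟩
  have : (1 : ℤ) ≤ ((s + 1 : ℕ) : ℤ) ∧ ((s + 1 : ℕ) : ℤ) ≤ m := by omega
  simp only [gG, this, and_self, dite_true]
  rw [Pi.basisFun_apply]
  congr 1
  ext
  simp

theorem span_image2_tmul {V W : Type*} [AddCommGroup V] [Module k V] [AddCommGroup W] [Module k W]
    {s : Set V} {t : Set W} (hs : Submodule.span k s = ⊤) (ht : Submodule.span k t = ⊤) :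
    Submodule.span k (Set.image2 (fun x y => x ⊗ₜ[k] y) s t) = ⊤ := by
  have := Submodule.map₂_span_span k (TensorProduct.mk k V W) s t
  rw [hs, ht, TensorProduct.map₂_mk_top_top_eq_top] at this
  exact this.symm

theorem span_enVec (q : ℕ) :
    Submodule.span k (enVec k n q '' (enValid n q : Set (ENIdx a q))) = ⊤ := by
  rw [eq_top_iff, ← span_image2_tmul (span_image2_tmul (span_monSU (k := k) a ((n : ℤ) - q))
    (span_wedge a q)) (span_gG (q - 1))]
  refine Submodule.span_mono ?_
  rintro _ ⟨_, ⟨_, ⟨μ, hμ, rfl⟩, _, ⟨J, hJ, rfl⟩, rfl⟩, _, ⟨h, hh, rfl⟩, rfl⟩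
  refine ⟨(μ, J, h), ⟨?_, hJ, hh.1, ?_⟩, rfl⟩
  · have : (μ.degree : ℤ) = (n : ℤ) - q := hμ
    simp only
    omega
  · have := hh.1
    have := hh.2
    simp only
    omega

/-- The functional reading off the coefficient of `x^μ` on `S^m U`. -/
def coeffSU (m : ℤ) (μ : Fin (a + 1) →₀ ℕ) : SU k a m →ₗ[k] k :=
  MvPolynomial.lcoeff k μ ∘ₗ (SU k a m).subtype

theorem coeffSU_monSU {m : ℤ} (μ ν : Fin (a + 1) →₀ ℕ) (h : (ν.degree : ℤ) = m) :
    coeffSU a m μ (monSU k m ν) = if ν = μ then 1 else 0 := by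
  simp [coeffSU, coe_monSU a h, MvPolynomial.coeff_monomial]

/-- The functional on `Λ^q G_a` dual to `g_J`. -/
def wedgeDual (q : ℕ) (J : Fin q → Fin a) : ⋀[k]^q (Fin a → k) →ₗ[k] k :=
  exteriorPower.pairingDual k (Fin a → k) q
    (exteriorPower.ιMulti k q fun t => LinearMap.proj (J t))

theorem wedgeDual_self (q : ℕ) {J : Fin q → Fin a} (hJ : StrictMono J) :
    wedgeDual a q J (wedge k q fun t => Pi.single (J t) 1) = 1 := by
  have := exteriorPower.pairingDual_apply_apply_eq_one (R := k)
    (fun i : Fin a => (Pi.single i 1 : Fin a → k)) (fun i => LinearMap.proj i) (by simp)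
    (by intro i j hij; simp [hij]) q (OrderEmbedding.ofStrictMono J hJ)
  exact this

theorem wedgeDual_of_ne (q : ℕ) {J J' : Fin q → Fin a} (hJ : StrictMono J) (hJ' : StrictMono J')
    (hne : J ≠ J') : wedgeDual a q J (wedge k q fun t => Pi.single (J' t) 1) = 0 := by
  have := exteriorPower.pairingDual_apply_apply_eq_one_zero (R := k)
    (fun i : Fin a => (Pi.single i 1 : Fin a → k)) (fun i => LinearMap.proj i)
    (by intro i j hij; simp [hij]) q (OrderEmbedding.ofStrictMono J hJ)
    (OrderEmbedding.ofStrictMono J' hJ') (fun h => hne (congrArg DFunLike.coe h))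
  exact this

/-- The functional on `G_m` reading off the coefficient of `g_h`. -/
def gDual (m h : ℕ) : (Fin m → k) →ₗ[k] k :=
  if H : 1 ≤ h ∧ h ≤ m then LinearMap.proj (⟨h - 1, by omega⟩ : Fin m) else 0

theorem gDual_gG {m h h' : ℕ} (H : 1 ≤ h ∧ h ≤ m) (H' : 1 ≤ h' ∧ h' ≤ m) :
    gDual m h (gG k m h') = if h = h' then 1 else 0 := by
  have H2 : (1 : ℤ) ≤ (h' : ℤ) ∧ (h' : ℤ) ≤ m := by omega
  simp only [gDual, H, H2, gG, and_self, dite_true, LinearMap.proj_apply, Pi.single_apply,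
    Fin.mk.injEq]
  refine if_congr ?_ rfl rfl
  omega

variable (k n) in
/-- The functional dual to `enVec`. -/
def enDual (q : ℕ) (i : ENIdx a q) : ENTerm k a n q →ₗ[k] k :=
  LinearMap.mul' k k ∘ₗ TensorProduct.map
    (LinearMap.mul' k k ∘ₗ TensorProduct.map (coeffSU a ((n : ℤ) - q) i.1) (wedgeDual a q i.2.1))
    (gDual (q - 1) i.2.2)

theorem enDual_enVec (q : ℕ) (i j : ENIdx a q) :
    enDual k a n q i (enVec k n q j) =
      coeffSU a ((n : ℤ) - q) i.1 (monSU k ((n : ℤ) - q) j.1) *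
        wedgeDual a q i.2.1 (wedge k q fun t => Pi.single (j.2.1 t) 1) *
        gDual (q - 1) i.2.2 (gG k (q - 1) j.2.2) := by
  simp [enDual, enVec]

theorem enDual_self (q : ℕ) (i : ENIdx a q) (hi : i ∈ enValid n q) :
    enDual k a n q i (enVec k n q i) = 1 := by
  obtain ⟨h1, h2, h3, h4⟩ := hi
  rw [enDual_enVec, coeffSU_monSU _ _ _ (by omega), wedgeDual_self a q h2,
    gDual_gG (by omega) (by omega)]
  simp

theorem enDual_of_ne (q : ℕ) (i : ENIdx a q) (hi : i ∈ enValid n q) (j : ENIdx a q)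
    (hj : j ∈ enValid n q) (hne : i ≠ j) : enDual k a n q i (enVec k n q j) = 0 := by
  obtain ⟨h1, h2, h3, h4⟩ := hi
  obtain ⟨h1', h2', h3', h4'⟩ := hj
  rw [enDual_enVec]
  by_cases e1 : i.2.1 = j.2.1
  · rw [coeffSU_monSU _ _ _ (by omega), gDual_gG (by omega) (by omega)]
    by_cases e2 : j.1 = i.1
    · rw [if_neg (c := i.2.2 = j.2.2), mul_zero]
      exact fun e3 => hne (Prod.ext e2.symm (Prod.ext e1 e3))
    · rw [if_neg e2, zero_mul, zero_mul]
  · rw [wedgeDual_of_ne a q h2 h2' e1, mul_zero, zero_mul]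

theorem enVec_eq_zero (q : ℕ) (i : ENIdx a q) (hi : ¬ (1 ≤ i.2.2 ∧ i.2.2 + 1 ≤ q)) :
    enVec k n q i = 0 := by
  have : ¬ ((1 : ℤ) ≤ (i.2.2 : ℤ) ∧ (i.2.2 : ℤ) ≤ ((q - 1 : ℕ) : ℤ)) := by omega
  simp only [enVec, gG, this, dite_false, TensorProduct.tmul_zero]

theorem xSU_monSU {q : ℕ} (i : Fin (a + 1)) (μ : Fin (a + 1) →₀ ℕ) (h : μ.degree + (q + 1) = n) :
    xSU i (monSU k ((n : ℤ) - (q + 1 : ℕ)) μ) = monSU k ((n : ℤ) - q) (μ + Finsupp.single i 1) := by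
  apply Subtype.ext
  change X i * (monSU k ((n : ℤ) - (q + 1 : ℕ)) μ : MvPolynomial (Fin (a + 1)) k) = _
  rw [coe_monSU a (by omega), coe_monSU a (by rw [map_add, Finsupp.degree_single]; omega),
    X, monomial_mul, add_comm μ, mul_one]

end Basis

section Differential

variable {k : Type*} [Field k] {a n : ℕ}

/-- The formula for the differential `d_{q+1}` on decomposable tensors. -/
def IsENDiff (q : ℕ) (d : ENTerm k a n (q + 1) →ₗ[k] ENTerm k a n q) : Prop :=
  ∀ (m : SU k a ((n : ℤ) - (q + 1 : ℕ))) (J : Fin (q + 1) → Fin a) (h : ℤ),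
    d ((m ⊗ₜ[k] wedge k (q + 1) (fun t => Pi.single (J t) 1)) ⊗ₜ[k] gG k (q + 1 - 1) h) =
      ∑ t : Fin (q + 1), ((-1 : k) ^ ((t : ℕ) + 1)) •
        (((xSU (J t).castSucc m ⊗ₜ[k] wedge k q (fun s => Pi.single (J (t.succAbove s)) 1)) ⊗ₜ[k]
            gG k (q - 1) (h - 1))
          - ((xSU (J t).succ m ⊗ₜ[k] wedge k q (fun s => Pi.single (J (t.succAbove s)) 1)) ⊗ₜ[k]
            gG k (q - 1) h))

/-- The formula for the differential `d_2` on decomposable tensors. -/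
def IsENQuad (d : ENTerm k a n 2 →ₗ[k] SU k a (n : ℤ)) : Prop :=
  ∀ (m : SU k a ((n : ℤ) - (2 : ℕ))) (J : Fin 2 → Fin a),
    (d ((m ⊗ₜ[k] wedge k 2 (fun t => Pi.single (J t) 1)) ⊗ₜ[k] gG k (2 - 1) 1) :
        MvPolynomial (Fin (a + 1)) k) =
      (X (J 0).castSucc * X (J 1).succ - X (J 0).succ * X (J 1).castSucc) *
        (m : MvPolynomial (Fin (a + 1)) k)

theorem IsENDiff.apply_enVec {q : ℕ} {d : ENTerm k a n (q + 1) →ₗ[k] ENTerm k a n q}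
    (hd : IsENDiff q d) (μ : Fin (a + 1) →₀ ℕ) (J : Fin (q + 1) → Fin a) (h : ℕ)
    (hμ : μ.degree + (q + 1) = n) (hh : 1 ≤ h) :
    d (enVec k n (q + 1) (μ, J, h)) =
      ∑ t : Fin (q + 1), ((-1 : k) ^ ((t : ℕ) + 1)) •
        (enVec k n q (μ + Finsupp.single (J t).castSucc 1, J ∘ t.succAbove, h - 1) -
          enVec k n q (μ + Finsupp.single (J t).succ 1, J ∘ t.succAbove, h)) := by
  rw [enVec, hd]
  refine Finset.sum_congr rfl fun t _ => ?_
  simp only [enVec, xSU_monSU a _ μ hμ, Function.comp_apply]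
  rw [Nat.cast_sub hh, Nat.cast_one]

theorem IsENQuad.apply_enVec {d : ENTerm k a n 2 →ₗ[k] SU k a (n : ℤ)}
    (hd : IsENQuad d) (μ : Fin (a + 1) →₀ ℕ) (J : Fin 2 → Fin a) (hμ : μ.degree + 2 = n) :
    d (enVec k n 2 (μ, J, 1)) =
      monSU k n (μ + Finsupp.single (J 0).castSucc 1 + Finsupp.single (J 1).succ 1) -
      monSU k n (μ + Finsupp.single (J 0).succ 1 + Finsupp.single (J 1).castSucc 1) := by
  apply Subtype.ext
  have hdeg : ∀ i j : Fin (a + 1),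
      (((μ + Finsupp.single i 1 + Finsupp.single j 1).degree : ℕ) : ℤ) = n := by
    intro i j
    rw [map_add, map_add, Finsupp.degree_single, Finsupp.degree_single]
    omega
  have hm : ∀ i j : Fin (a + 1), (monomial (μ + Finsupp.single i 1 + Finsupp.single j 1) (1 : k)) =
      X i * X j * monomial μ 1 := by
    intro i j
    rw [X, X, monomial_mul, monomial_mul, mul_one, mul_one, add_assoc, add_comm μ]
  have := hd (monSU k ((n : ℤ) - (2 : ℕ)) μ) J
  rw [coe_monSU a (by omega)] at this
  rw [Submodule.coe_sub, coe_monSU a (hdeg _ _), coe_monSU a (hdeg _ _), hm, hm, ← sub_mul]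
  exact this

theorem sum_sum_neg_one_pow_smul_eq_zero {M : Type*} [AddCommGroup M] [Module k M] {q : ℕ}
    (F : Fin (q + 2) → Fin (q + 1) → M)
    (hF : ∀ t s, F (t.succAbove s) (s.predAbove t) = F t s) :
    ∑ t : Fin (q + 2), ∑ s : Fin (q + 1), ((-1 : k) ^ ((t : ℕ) + (s : ℕ))) • F t s = 0 := by
  rw [← Finset.sum_product']
  refine Finset.sum_involution (fun x _ => (x.1.succAbove x.2, x.2.predAbove x.1)) ?_ ?_ ?_ ?_
  · rintro ⟨t, s⟩ -
    simp only [hF, Fin.neg_one_pow_succAbove_add_predAbove, neg_smul, add_neg_cancel]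
  · rintro ⟨t, s⟩ - - h
    exact Fin.succAbove_ne t s (congrArg Prod.fst h)
  · simp
  · rintro ⟨t, s⟩ -
    simp only [Fin.succAbove_succAbove_predAbove, Fin.predAbove_predAbove_succAbove]

theorem xSU_comm {q : ℕ} (i j : Fin (a + 1)) (m : SU k a ((n : ℤ) - (q + 1 + 1 : ℕ))) :
    (xSU i (xSU j m) : SU k a ((n : ℤ) - q)) = xSU j (xSU i m) :=
  Subtype.ext (mul_left_comm (X i) (X j) (m : MvPolynomial (Fin (a + 1)) k))

theorem smul_sub_smul_sub {M : Type*} [AddCommGroup M] [Module k M] (c c' : k) (x y z w : M) :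
    c • (c' • (x - y) - c' • (z - w)) = (c * c') • (x - y - z + w) := by
  module

theorem IsENDiff.comp_eq_zero {q : ℕ} {d : ENTerm k a n (q + 1) →ₗ[k] ENTerm k a n q}
    {d' : ENTerm k a n (q + 1 + 1) →ₗ[k] ENTerm k a n (q + 1)} (hd : IsENDiff q d)
    (hd' : IsENDiff (q + 1) d') : d ∘ₗ d' = 0 := by
  refine LinearMap.ext_on (span_enVec a (q + 1 + 1)) ?_
  rintro _ ⟨⟨μ, J, h⟩, -, rfl⟩
  rw [LinearMap.comp_apply, enVec, hd' _ J h, LinearMap.zero_apply, map_sum]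
  simp only
  set m := monSU k ((n : ℤ) - (q + 1 + 1 : ℕ)) μ
  let W : Fin (q + 1 + 1) → Fin (q + 1) → ⋀[k]^q (Fin a → k) := fun t s =>
    wedge k q (fun r => Pi.single (J (t.succAbove (s.succAbove r))) 1)
  let F : Fin (q + 1 + 1) → Fin (q + 1) → ENTerm k a n q := fun t s =>
    (xSU (J t).castSucc (xSU (J (t.succAbove s)).castSucc m) ⊗ₜ[k] W t s) ⊗ₜ[k]
        gG k (q - 1) ((h : ℤ) - 1 - 1)
      - (xSU (J t).castSucc (xSU (J (t.succAbove s)).succ m) ⊗ₜ[k] W t s) ⊗ₜ[k]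
        gG k (q - 1) ((h : ℤ) - 1)
      - (xSU (J t).succ (xSU (J (t.succAbove s)).castSucc m) ⊗ₜ[k] W t s) ⊗ₜ[k]
        gG k (q - 1) ((h : ℤ) - 1)
      + (xSU (J t).succ (xSU (J (t.succAbove s)).succ m) ⊗ₜ[k] W t s) ⊗ₜ[k]
        gG k (q - 1) (h : ℤ)
  have hF : ∀ t s, F (t.succAbove s) (s.predAbove t) = F t s := by
    intro t s
    simp only [F, W, Fin.succAbove_succAbove_predAbove,
      Fin.succAbove_succAbove_succAbove_predAbove, xSU_comm (J (t.succAbove s)).castSucc,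
      xSU_comm (J (t.succAbove s)).succ]
    abel
  rw [← sum_sum_neg_one_pow_smul_eq_zero (k := k) F hF]
  refine Finset.sum_congr rfl fun t _ => ?_
  rw [map_smul, map_sub, hd _ (fun s => J (t.succAbove s)), hd _ (fun s => J (t.succAbove s)),
    ← Finset.sum_sub_distrib, Finset.smul_sum]
  refine Finset.sum_congr rfl fun s _ => ?_
  have hsign : ((-1 : k)) ^ ((t : ℕ) + (s : ℕ)) = (-1) ^ ((t : ℕ) + 1) * (-1) ^ ((s : ℕ) + 1) := by
    rw [pow_add, pow_succ, pow_succ]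
    ring
  simp only [F, W, xSU_comm (J t).castSucc, xSU_comm (J t).succ]
  rw [hsign]
  exact smul_sub_smul_sub (M := ENTerm k a n q) _ _ _ _ _ _

theorem gG_eq_zero {m : ℕ} {h : ℤ} (H : ¬ (1 ≤ h ∧ h ≤ m)) : gG k m h = 0 := by
  rw [gG, dif_neg H]

theorem IsENQuad.comp_eq_zero {d : ENTerm k a n 2 →ₗ[k] SU k a (n : ℤ)}
    {d' : ENTerm k a n (2 + 1) →ₗ[k] ENTerm k a n 2} (hd : IsENQuad d)
    (hd' : IsENDiff 2 d') : d ∘ₗ d' = 0 := by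
  refine LinearMap.ext_on (span_enVec a (2 + 1)) ?_
  rintro _ ⟨⟨μ, J, h⟩, ⟨-, -, h1, h2⟩, rfl⟩
  rw [LinearMap.comp_apply, enVec, hd' _ J h, LinearMap.zero_apply, map_sum]
  apply Subtype.ext
  rw [Submodule.coe_sum, Fin.sum_univ_three]
  have hz : ∀ (x : SU k a ((n : ℤ) - (2 : ℕ)) ⊗[k] ⋀[k]^2 (Fin a → k)) (h : ℤ), h ≠ 1 →
      x ⊗ₜ[k] gG k (2 - 1) h = 0 := by
    intro x h hh
    rw [gG_eq_zero (by simp; omega), TensorProduct.tmul_zero]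
  have hcases : h = 1 ∨ h = 2 := by simp only at h1 h2; omega
  have e : ∀ (i : Fin (a + 1)) (m : SU k a ((n : ℤ) - (2 + 1 : ℕ))),
    ((xSU i m : SU k a ((n : ℤ) - (2 : ℕ))) : MvPolynomial (Fin (a + 1)) k) =
      X i * (m : MvPolynomial (Fin (a + 1)) k) :=
      fun i m => rfl
  have s00 : (0 : Fin 3).succAbove (0 : Fin 2) = 1 := rfl
  have s01 : (0 : Fin 3).succAbove (1 : Fin 2) = 2 := rfl
  have s10 : (1 : Fin 3).succAbove (0 : Fin 2) = 0 := rfl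
  have s11 : (1 : Fin 3).succAbove (1 : Fin 2) = 2 := rfl
  have s20 : (2 : Fin 3).succAbove (0 : Fin 2) = 0 := rfl
  have s21 : (2 : Fin 3).succAbove (1 : Fin 2) = 1 := rfl
  have key : ∀ (t : Fin 3) (m : SU k a ((n : ℤ) - (2 : ℕ))), (d ((m ⊗ₜ[k] wedge k 2
      (fun s => Pi.single (J (t.succAbove s)) 1)) ⊗ₜ[k] gG k (2 - 1) 1) :
        MvPolynomial (Fin (a + 1)) k) = _ := fun t m => hd m (fun s => J (t.succAbove s))
  rcases hcases with rfl | rfl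
  · simp only [Nat.cast_one, hz _ ((1 : ℤ) - 1) (by norm_num), zero_sub, map_smul, map_neg,
      Submodule.coe_smul, Submodule.coe_neg, key, e, s00, s01, s10, s11, s20, s21,
      MvPolynomial.smul_eq_C_mul]
    simp
    ring
  · simp only [hz _ ((2 : ℕ) : ℤ) (by norm_num), sub_zero, map_smul,
      show ((2 : ℕ) : ℤ) - 1 = 1 by norm_num,
      Submodule.coe_smul, key, e, s00, s01, s10, s11, s20, s21, MvPolynomial.smul_eq_C_mul]
    simp
    ring

end Differential

section Matching

variable {k : Type*} [Field k] {a n q : ℕ}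

/-- Some variable `x_j` with `1 ≤ j < j_1` divides `x^μ`, where `j_1` is the least element of
`J`. -/
def enLow (i : ENIdx a q) : Prop :=
  ∃ j : Fin (a + 1), j ≠ 0 ∧ i.1 j ≠ 0 ∧ ∀ t, (j : ℕ) ≤ i.2.1 t

/-- Some variable `x_j` with `j_q ≤ j < a` divides `x^μ`, where `j_q` is the greatest element of
`J`. -/
def enHigh (i : ENIdx a q) : Prop :=
  ∃ j : Fin (a + 1), (j : ℕ) < a ∧ i.1 j ≠ 0 ∧ ∀ t, (i.2.1 t : ℕ) < j

variable (n q) in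
/-- The basis indices which are matched with an index of homological degree one higher. -/
def enTarget : Set (ENIdx a q) :=
  {i ∈ enValid n q | enLow i ∨ (i.2.2 + 1 = q ∧ enHigh i)}

variable (n q) in
/-- The basis indices which are matched with an index of homological degree one lower. -/
def enSource : Set (ENIdx a q) := enValid n q \ enTarget n q

/-- The matching from source indices to target indices of homological degree one lower. -/
def enPartner (i : ENIdx a (q + 1 + 1)) : ENIdx a (q + 1) :=
  if i.2.2 = q + 1 then
    (i.1 + Finsupp.single (i.2.1 (Fin.last _)).castSucc 1, i.2.1 ∘ Fin.castSucc, i.2.2 - 1)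
  else (i.1 + Finsupp.single (i.2.1 0).succ 1, i.2.1 ∘ Fin.succ, i.2.2)

variable (a) in
/-- A strictly concave weight on the variables. -/
def varWeight (j : ℕ) : ℕ := ∑ l ∈ Finset.range j, (a - l)

theorem varWeight_succ (j : ℕ) : varWeight a (j + 1) = varWeight a j + (a - j) :=
  Finset.sum_range_succ _ _

/-- The weight of a monomial. -/
def monWeight (μ : Fin (a + 1) →₀ ℕ) : ℕ := ∑ j, μ j * varWeight a j

theorem monWeight_add_single (μ : Fin (a + 1) →₀ ℕ) (j : Fin (a + 1)) :
    monWeight (μ + Finsupp.single j 1) = monWeight μ + varWeight a j := by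
  simp [monWeight, add_mul, Finset.sum_add_distrib, Finsupp.single_apply]

/-- The weight of an index. -/
def enWeight (i : ENIdx a (q + 1)) : ℕ :=
  monWeight i.1 + ∑ t, varWeight a (i.2.1 t) + (a - i.2.1 0)

theorem enWeight_succAbove_castSucc (μ : Fin (a + 1) →₀ ℕ) (J : Fin (q + 1 + 1) → Fin a)
    (t : Fin (q + 1 + 1)) (h : ℕ) :
    enWeight (μ + Finsupp.single (J t).castSucc 1, J ∘ t.succAbove, h) =
      monWeight μ + ∑ t, varWeight a (J t) + (a - J (t.succAbove 0)) := by
  simp only [enWeight, monWeight_add_single, Function.comp_apply, Fin.sum_univ_succAbove _ t,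
    Fin.val_castSucc]
  ring

theorem enWeight_succAbove_succ (μ : Fin (a + 1) →₀ ℕ) (J : Fin (q + 1 + 1) → Fin a)
    (t : Fin (q + 1 + 1)) (h : ℕ) :
    enWeight (μ + Finsupp.single (J t).succ 1, J ∘ t.succAbove, h) =
      monWeight μ + ∑ t, varWeight a (J t) + (a - J t) + (a - J (t.succAbove 0)) := by
  simp only [enWeight, monWeight_add_single, Function.comp_apply, Fin.sum_univ_succAbove _ t,
    Fin.val_succ, varWeight_succ]
  ring

open Classical in
/-- The rank with respect to which the differential is triangular. -/
def enRank (i : ENIdx a (q + 1)) : ℕ ×ₗ ℕ :=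
  toLex (i.2.2, 2 * enWeight i + if enLow i then 1 else 0)

theorem not_enLow_add_single {q' : ℕ} {μ : Fin (a + 1) →₀ ℕ} {J : Fin (q + 1) → Fin a} {h h' : ℕ}
    (hJ : StrictMono J) (hlow : ¬ enLow (μ, J, h)) {c : Fin (a + 1)} (hc : (J 0 : ℕ) < c)
    {J' : Fin q' → Fin a} {s : Fin q'} (hs : J' s = J 0) :
    ¬ enLow (μ + Finsupp.single c 1, J', h') := by
  rintro ⟨j, hj0, hj, hjJ⟩
  have hjs : (j : ℕ) ≤ J 0 := hs ▸ hjJ s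
  have hjc : c ≠ j := by
    rintro rfl
    omega
  refine hlow ⟨j, hj0, ?_, fun t => hjs.trans (hJ.monotone (Fin.zero_le t))⟩
  simpa [Finsupp.single_apply, hjc] using hj

theorem not_enHigh_add_single {q' : ℕ} {μ : Fin (a + 1) →₀ ℕ} {J : Fin (q + 1) → Fin a} {h h' : ℕ}
    (hJ : StrictMono J) (hhigh : ¬ enHigh (μ, J, h)) {c : Fin (a + 1)}
    (hc : (c : ℕ) ≤ J (Fin.last q)) {J' : Fin q' → Fin a} {s : Fin q'}
    (hs : J' s = J (Fin.last q)) :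
    ¬ enHigh (μ + Finsupp.single c 1, J', h') := by
  rintro ⟨j, hj0, hj, hjJ⟩
  have hjs : (J (Fin.last q) : ℕ) < j := hs ▸ hjJ s
  have hjc : c ≠ j := by
    rintro rfl
    omega
  refine hhigh ⟨j, hj0, ?_, fun t => lt_of_le_of_lt (hJ.monotone (Fin.le_last t)) hjs⟩
  simpa [Finsupp.single_apply, hjc] using hj

theorem degree_add_single (μ : Fin (a + 1) →₀ ℕ) (c : Fin (a + 1)) :
    (μ + Finsupp.single c 1).degree = μ.degree + 1 := by
  rw [map_add, Finsupp.degree_single]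

theorem enPartner_mapsTo (hq : 1 ≤ q) :
    Set.MapsTo enPartner (enSource (a := a) n (q + 1 + 1)) (enTarget n (q + 1)) := by
  rintro ⟨μ, J, h⟩ ⟨⟨h1, h2, h3, h4⟩, -⟩
  simp only at h1 h2 h3 h4
  by_cases hh : h = q + 1
  · subst hh
    simp only [enPartner, if_true]
    refine ⟨⟨?_, h2.comp Fin.strictMono_castSucc, ?_, ?_⟩, Or.inr ⟨?_, ?_⟩⟩
    · simp only [degree_add_single]
      omega
    · simp only
      omega
    · simp only
      omega
    · simp only
      omega
    · refine ⟨(J (Fin.last _)).castSucc, (J (Fin.last _)).2, by simp, fun t => ?_⟩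
      exact h2 (Fin.castSucc_lt_last t)
  · simp only [enPartner, if_neg hh]
    refine ⟨⟨?_, h2.comp Fin.strictMono_succ, h3, ?_⟩, Or.inl ?_⟩
    · simp only [degree_add_single]
      omega
    · simp only
      omega
    · refine ⟨(J 0).succ, Fin.succ_ne_zero _, by simp, fun t => ?_⟩
      have := h2 (Fin.succ_pos t)
      simp only [Fin.val_succ, Function.comp_apply]
      omega

theorem exists_enPartner_eq {j : ENIdx a (q + 1)} (hj : j ∈ enTarget n (q + 1)) :
    ∃ i ∈ enSource n (q + 1 + 1), enPartner i = j := by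
  obtain ⟨μ, J, h⟩ := j
  obtain ⟨⟨h1, h2, h3, h4⟩, h5⟩ := hj
  simp only at h1 h2 h3 h4 h5
  have hsub : ∀ x : Fin (a + 1), μ x ≠ 0 → μ - Finsupp.single x 1 + Finsupp.single x 1 = μ :=
    fun x hx => tsub_add_cancel_of_le (by
      rw [Finsupp.single_le_iff]
      omega)
  have hle : ∀ x y : Fin (a + 1), (μ - Finsupp.single x 1 : Fin (a + 1) →₀ ℕ) y ≠ 0 → μ y ≠ 0 := by
    intro x y hy h0
    apply hy
    rw [Finsupp.tsub_apply, h0, Nat.zero_sub]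
  by_cases hlow : enLow (μ, J, h)
  · obtain ⟨x, ⟨hx0, hxμ, hxJ⟩, hmin⟩ := Set.exists_min_image
      {x : Fin (a + 1) | x ≠ 0 ∧ μ x ≠ 0 ∧ ∀ t, (x : ℕ) ≤ J t} id (Set.toFinite _) hlow
    have hx1 : 1 ≤ (x : ℕ) := Nat.one_le_iff_ne_zero.2 fun h0 => hx0 (Fin.ext h0)
    let y : Fin a := ⟨x - 1, by omega⟩
    have hy : y.succ = x := by
      ext
      simp only [y, Fin.val_succ]
      omega
    have hmono : StrictMono (Fin.cons y J : Fin (q + 1 + 1) → Fin a) := by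
      refine Fin.strictMono_iff_lt_succ.2 fun t => ?_
      refine Fin.cases ?_ (fun s => ?_) t
      · have := hxJ 0
        rw [Fin.castSucc_zero, Fin.cons_zero, Fin.cons_succ, Fin.lt_def]
        simp only [y]
        omega
      · rw [← Fin.succ_castSucc, Fin.cons_succ, Fin.cons_succ]
        exact h2 Fin.castSucc_lt_succ
    have hd := congrArg Finsupp.degree (hsub x hxμ)
    rw [degree_add_single] at hd
    refine ⟨(μ - Finsupp.single x 1, Fin.cons y J, h), ⟨⟨?_, hmono, h3, ?_⟩, ?_⟩, ?_⟩
    · simp only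
      omega
    · simp only
      omega
    · rintro ⟨-, ⟨z, hz0, hzμ, hzJ⟩ | ⟨hh, -⟩⟩
      · have hz1 := hzJ 0
        have := hmin z ⟨hz0, hle x z hzμ, fun t => by simpa using hzJ t.succ⟩
        simp only [Fin.cons_zero, y, id, Fin.le_def] at hz1 this
        omega
      · simp only at hh
        omega
    · rw [enPartner, if_neg (by simp only; omega)]
      simp only [Fin.cons_zero, hy, hsub x hxμ]
      rfl
  · obtain ⟨hh, hhigh⟩ := h5.resolve_left hlow
    obtain ⟨x, ⟨hx0, hxμ, hxJ⟩, hmax⟩ := Set.exists_max_image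
      {x : Fin (a + 1) | (x : ℕ) < a ∧ μ x ≠ 0 ∧ ∀ t, (J t : ℕ) < x} id (Set.toFinite _) hhigh
    let y : Fin a := ⟨x, hx0⟩
    have hy : y.castSucc = x := rfl
    have hmono : StrictMono (Fin.snoc J y : Fin (q + 1 + 1) → Fin a) := by
      refine Fin.strictMono_iff_lt_succ.2 fun t => ?_
      refine Fin.lastCases ?_ (fun s => ?_) t
      · rw [Fin.snoc_castSucc (α := fun _ => Fin a), Fin.succ_last,
          Fin.snoc_last (α := fun _ => Fin a)]
        exact hxJ _
      · rw [Fin.succ_castSucc, Fin.snoc_castSucc (α := fun _ => Fin a),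
          Fin.snoc_castSucc (α := fun _ => Fin a)]
        exact h2 Fin.castSucc_lt_succ
    have hd := congrArg Finsupp.degree (hsub x hxμ)
    rw [degree_add_single] at hd
    refine ⟨(μ - Finsupp.single x 1, Fin.snoc J y, h + 1), ⟨⟨?_, hmono, ?_, ?_⟩, ?_⟩, ?_⟩
    · simp only
      omega
    · simp only
      omega
    · simp only
      omega
    · rintro ⟨-, ⟨z, hz0, hzμ, hzJ⟩ | ⟨-, z, hz0, hzμ, hzJ⟩⟩
      · exact hlow ⟨z, hz0, hle x z hzμ, fun t => by
          simpa [Fin.snoc_castSucc (α := fun _ => Fin a)] using hzJ t.castSucc⟩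
      · have hz1 := hzJ (Fin.last _)
        have := hmax z ⟨hz0, hle x z hzμ, fun t => by
          simpa [Fin.snoc_castSucc (α := fun _ => Fin a)] using hzJ t.castSucc⟩
        simp only [Fin.snoc_last (α := fun _ => Fin a), y, id, Fin.le_def] at hz1 this
        omega
    · rw [enPartner, if_pos (by simp only; omega)]
      simp only [Fin.snoc_last (α := fun _ => Fin a), hy, hsub x hxμ, Nat.add_sub_cancel]
      congr 2
      ext t
      simp [Fin.snoc_castSucc (α := fun _ => Fin a)]

/-- If `x_c x^μ = x_d x^ν` with `c ≠ d`, then `x_d` divides `x^μ`. -/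
theorem ne_zero_of_add_single_eq {μ ν : Fin (a + 1) →₀ ℕ} {c d : Fin (a + 1)} (hcd : c ≠ d)
    (h : μ + Finsupp.single c 1 = ν + Finsupp.single d 1) : μ d ≠ 0 := by
  have := DFunLike.congr_fun h d
  simp only [Finsupp.add_apply, Finsupp.single_apply, if_neg hcd, if_true] at this
  omega

theorem enPartner_injOn :
    Set.InjOn enPartner (enSource (a := a) n (q + 1 + 1)) := by
  have hlast : ∀ {μ ν : Fin (a + 1) →₀ ℕ} {J K : Fin (q + 1 + 1) → Fin a} {h : ℕ},
      StrictMono J → ¬ enHigh (μ, J, h) →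
      μ + Finsupp.single (J (Fin.last _)).castSucc 1 =
        ν + Finsupp.single (K (Fin.last _)).castSucc 1 → K (Fin.last _) ≤ J (Fin.last _) := by
    intro μ ν J K h hJ hhigh heq
    by_contra hlt
    rw [not_le] at hlt
    refine hhigh ⟨(K (Fin.last _)).castSucc, (K (Fin.last _)).2,
      ne_zero_of_add_single_eq (fun e => hlt.ne (Fin.castSucc_injective _ e)) heq, fun t => ?_⟩
    exact lt_of_le_of_lt (hJ.monotone (Fin.le_last t)) hlt
  have hfirst : ∀ {μ ν : Fin (a + 1) →₀ ℕ} {J K : Fin (q + 1 + 1) → Fin a} {h : ℕ},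
      StrictMono J → ¬ enLow (μ, J, h) →
      μ + Finsupp.single (J 0).succ 1 = ν + Finsupp.single (K 0).succ 1 → J 0 ≤ K 0 := by
    intro μ ν J K h hJ hlow heq
    by_contra hlt
    rw [not_le] at hlt
    refine hlow ⟨(K 0).succ, Fin.succ_ne_zero _,
      ne_zero_of_add_single_eq (fun e => hlt.ne' (Fin.succ_injective _ e)) heq, fun t => ?_⟩
    exact lt_of_lt_of_le hlt (hJ.monotone (Fin.zero_le t))
  have hmixed : ∀ {μ ν : Fin (a + 1) →₀ ℕ} {J K : Fin (q + 1 + 1) → Fin a} {h : ℕ},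
      StrictMono J → StrictMono K → ¬ enLow (μ, J, h) → J ∘ Fin.castSucc = K ∘ Fin.succ →
      μ + Finsupp.single (J (Fin.last _)).castSucc 1 = ν + Finsupp.single (K 0).succ 1 → False := by
    intro μ ν J K h hJ hK hlow hJK heq
    refine not_enLow_add_single (c := (J (Fin.last _)).castSucc) (J' := J ∘ Fin.castSucc) (s := 0)
      (h' := 0) hJ hlow (hJ (Fin.last_pos)) rfl ?_
    rw [heq, hJK]
    refine ⟨(K 0).succ, Fin.succ_ne_zero _, by simp, fun t => ?_⟩
    exact hK (Fin.succ_pos t)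
  rintro ⟨μ, J, h⟩ ⟨⟨h1, h2, h3, h4⟩, h5⟩ ⟨ν, K, l⟩ ⟨⟨h1', h2', h3', h4'⟩, h5'⟩ heq
  have hlow : ¬ enLow (μ, J, h) := fun hl => h5 ⟨⟨h1, h2, h3, h4⟩, Or.inl hl⟩
  have hlow' : ¬ enLow (ν, K, l) := fun hl => h5' ⟨⟨h1', h2', h3', h4'⟩, Or.inl hl⟩
  simp only at h1 h2 h3 h4 h1' h2' h3' h4'
  by_cases hh : h = q + 1 <;> by_cases hl : l = q + 1
  · have hhigh : ¬ enHigh (μ, J, h) := fun hl => h5 ⟨⟨h1, h2, h3, h4⟩, Or.inr ⟨by simp [hh], hl⟩⟩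
    have hhigh' : ¬ enHigh (ν, K, l) := fun hl' =>
      h5' ⟨⟨h1', h2', h3', h4'⟩, Or.inr ⟨by simp [hl], hl'⟩⟩
    simp only [enPartner, if_pos hh, if_pos hl, Prod.mk.injEq] at heq
    obtain ⟨e1, e2, -⟩ := heq
    have e3 : J (Fin.last _) = K (Fin.last _) :=
      le_antisymm (hlast h2' hhigh' e1.symm) (hlast h2 hhigh e1)
    have e4 : J = K := funext fun t => Fin.lastCases e3 (fun s => congrFun e2 s) t
    rw [e3] at e1
    rw [add_right_cancel e1, e4, hh, hl]
  · simp only [enPartner, if_pos hh, if_neg hl, Prod.mk.injEq] at heq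
    exact (hmixed h2 h2' hlow heq.2.1 heq.1).elim
  · simp only [enPartner, if_neg hh, if_pos hl, Prod.mk.injEq] at heq
    exact (hmixed h2' h2 hlow' heq.2.1.symm heq.1.symm).elim
  · simp only [enPartner, if_neg hh, if_neg hl, Prod.mk.injEq] at heq
    obtain ⟨e1, e2, e5⟩ := heq
    have e3 : J 0 = K 0 :=
      le_antisymm (hfirst h2 hlow e1) (hfirst h2' hlow' e1.symm)
    have e4 : J = K := funext fun t => Fin.cases e3 (fun s => congrFun e2 s) t
    rw [e3] at e1
    rw [add_right_cancel e1, e4, e5]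

theorem enVec_mem_span {r : ℕ ×ₗ ℕ} {j : ENIdx a (q + 1)} (hdeg : j.1.degree + (q + 1) = n)
    (hmono : StrictMono j.2.1) (hr : j.2.2 + 1 ≤ q + 1 → j ∈ enTarget n (q + 1) → enRank j < r) :
    enVec k n (q + 1) j ∈ Submodule.span k (enVec k n (q + 1) ''
      (enSource n (q + 1) ∪ {i ∈ enTarget n (q + 1) | enRank i < r})) := by
  by_cases hh : 1 ≤ j.2.2 ∧ j.2.2 + 1 ≤ q + 1
  · have hv : j ∈ enValid n (q + 1) := ⟨hdeg, hmono, hh⟩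
    refine Submodule.subset_span ⟨j, ?_, rfl⟩
    by_cases hT : j ∈ enTarget n (q + 1)
    · exact Or.inr ⟨hT, hr hh.2 hT⟩
    · exact Or.inl ⟨hv, hT⟩
  · rw [enVec_eq_zero a _ _ hh]
    exact Submodule.zero_mem _

theorem neg_one_pow_smul_sub_add_sub_mem {M : Type*} [AddCommGroup M] [Module k M]
    {N : Submodule k M} {x y z : M} {e : ℕ} (he : e = 1) (hx : x ∈ N) (hz : z ∈ N) :
    (-1 : k) ^ e • (x - y) + z - (1 : k) • y ∈ N := by
  have : (-1 : k) ^ e • (x - y) + z - (1 : k) • y = z - x := by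
    subst he
    module
  rw [this]
  exact N.sub_mem hz hx

theorem IsENDiff.triangular
    {d : ENTerm k a n (q + 1 + 1) →ₗ[k] ENTerm k a n (q + 1)} (hd : IsENDiff (q + 1) d)
    (i : ENIdx a (q + 1 + 1)) (hi : i ∈ enSource n (q + 1 + 1)) :
    ∃ u : k, u ≠ 0 ∧ d (enVec k n (q + 1 + 1) i) - u • enVec k n (q + 1) (enPartner i) ∈
      Submodule.span k (enVec k n (q + 1) '' (enSource n (q + 1) ∪
        {j ∈ enTarget n (q + 1) | enRank j < enRank (enPartner i)})) := by
  obtain ⟨μ, J, h⟩ := i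
  obtain ⟨⟨h1, h2, h3, h4⟩, h5⟩ := hi
  have hlow : ¬ enLow (μ, J, h) := fun hl => h5 ⟨⟨h1, h2, h3, h4⟩, Or.inl hl⟩
  have hhigh : h = q + 1 → ¬ enHigh (μ, J, h) :=
    fun hh hl => h5 ⟨⟨h1, h2, h3, h4⟩, Or.inr ⟨by simp [hh], hl⟩⟩
  simp only at h1 h2 h3 h4
  have hdeg : ∀ c, (μ + Finsupp.single c 1).degree + (q + 1) = n := by
    intro c
    rw [degree_add_single]
    omega
  have hmono : ∀ t : Fin (q + 1 + 1), StrictMono (J ∘ t.succAbove) :=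
    fun t => h2.comp (Fin.strictMono_succAbove t)
  rw [hd.apply_enVec μ J h h1 h3]
  by_cases hh : h = q + 1
  · refine ⟨(-1) ^ (q + 1 + 1), by simp, ?_⟩
    have hB : ∀ c, ∀ J' : Fin (q + 1) → Fin a,
        enVec k n (q + 1) (μ + Finsupp.single c 1, J', h) = 0 :=
      fun c J' => enVec_eq_zero a _ _ (by simp only; omega)
    have hP : enPartner (μ, J, h) = (μ + Finsupp.single (J (Fin.last _)).castSucc 1,
        J ∘ (Fin.last _).succAbove, h - 1) := by
      simp only [enPartner, if_pos hh, Fin.succAbove_last]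
    rw [Fin.sum_univ_castSucc, hP]
    simp only [hB, sub_zero, Fin.val_last, add_sub_cancel_right]
    refine Submodule.sum_mem _ fun t _ => Submodule.smul_mem _ _ ?_
    refine enVec_mem_span (hdeg _) (hmono _) fun _ hT => ?_
    have hnh : ¬ enHigh (μ + Finsupp.single (J t.castSucc).castSucc 1,
        J ∘ t.castSucc.succAbove, h - 1) := by
      refine not_enHigh_add_single (s := Fin.last _) h2 (hhigh hh)
        (h2.monotone (Fin.le_last _)) ?_
      rw [Function.comp_apply, Fin.succAbove_of_le_castSucc _ _
        (Fin.castSucc_le_castSucc_iff.2 (Fin.le_last t)), Fin.succ_last]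
    have hl := hT.2.resolve_right fun h => hnh h.2
    have ht : t = 0 := by
      by_contra ht
      refine not_enLow_add_single (s := 0) h2 hlow (h2 ?_) ?_ hl
      · exact Fin.pos_of_ne_zero (by simpa using ht)
      · rw [Function.comp_apply, Fin.succAbove_ne_zero_zero]
        simpa using ht
    subst ht
    rw [enRank, enRank, Prod.Lex.toLex_lt_toLex]
    refine Or.inr ⟨rfl, ?_⟩
    simp only [enWeight_succAbove_castSucc]
    have h01 : J 0 < J 1 := h2 (by simp)
    have e0 : (Fin.castSucc (0 : Fin (q + 1))).succAbove (0 : Fin (q + 1)) = 1 := by simp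
    have e1 : (Fin.last (q + 1)).succAbove (0 : Fin (q + 1)) = 0 := by simp
    rw [e0, e1]
    have := (J 1).2
    split_ifs <;> omega
  · refine ⟨1, one_ne_zero, ?_⟩
    have hP : enPartner (μ, J, h) = (μ + Finsupp.single (J 0).succ 1,
        J ∘ (0 : Fin (q + 1 + 1)).succAbove, h) := by
      simp only [enPartner, if_neg hh, Fin.succAbove_zero]
    rw [hP]
    have hA : ∀ t : Fin (q + 1 + 1), enVec k n (q + 1)
        (μ + Finsupp.single (J t).castSucc 1, J ∘ t.succAbove, h - 1) ∈
          Submodule.span k (enVec k n (q + 1) '' (enSource n (q + 1) ∪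
            {j ∈ enTarget n (q + 1) | enRank j < enRank (μ + Finsupp.single (J 0).succ 1,
              J ∘ (0 : Fin (q + 1 + 1)).succAbove, h)})) := by
      refine fun t => enVec_mem_span (hdeg _) (hmono t) fun _ _ => ?_
      rw [enRank, enRank, Prod.Lex.toLex_lt_toLex]
      exact Or.inl (by simp only; omega)
    have hB : ∀ t : Fin (q + 1), enVec k n (q + 1)
        (μ + Finsupp.single (J t.succ).succ 1, J ∘ t.succ.succAbove, h) ∈
          Submodule.span k (enVec k n (q + 1) '' (enSource n (q + 1) ∪
            {j ∈ enTarget n (q + 1) | enRank j < enRank (μ + Finsupp.single (J 0).succ 1,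
              J ∘ (0 : Fin (q + 1 + 1)).succAbove, h)})) := by
      refine fun t => enVec_mem_span (hdeg _) (hmono _) fun _ _ => ?_
      have hnl : ¬ enLow (μ + Finsupp.single (J t.succ).succ 1, J ∘ t.succ.succAbove, h) := by
        refine not_enLow_add_single (s := 0) h2 hlow ?_ ?_
        · have := h2 (Fin.succ_pos t)
          simp only [Fin.val_succ]
          omega
        · simp
      have hpl : enLow (μ + Finsupp.single (J 0).succ 1,
          J ∘ (0 : Fin (q + 1 + 1)).succAbove, h) := by
        refine ⟨(J 0).succ, Fin.succ_ne_zero _, by simp, fun t => ?_⟩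
        have := h2 (Fin.succ_pos t)
        simp only [Fin.val_succ, Function.comp_apply, Fin.succAbove_zero]
        omega
      rw [enRank, enRank, Prod.Lex.toLex_lt_toLex]
      refine Or.inr ⟨rfl, ?_⟩
      simp only [enWeight_succAbove_succ, if_pos hpl, if_neg hnl]
      have e0 : (0 : Fin (q + 1 + 1)).succAbove (0 : Fin (q + 1)) = 1 := by simp
      have e1 : t.succ.succAbove (0 : Fin (q + 1)) = 0 := by simp
      have h1t : J 1 ≤ J t.succ := h2.monotone (by
        rw [← Fin.succ_zero_eq_one]
        exact Fin.succ_le_succ_iff.2 (Fin.zero_le t))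
      rw [e0, e1]
      have := (J 1).2
      omega
    rw [Fin.sum_univ_succ]
    refine neg_one_pow_smul_sub_add_sub_mem (M := ENTerm k a n (q + 1)) rfl (hA 0)
      (Submodule.sum_mem _ fun t _ => Submodule.smul_mem _ _ ?_)
    exact Submodule.sub_mem _ (hA _) (hB _)

end Matching

section LowDegree

variable {k : Type*} [Field k] {a n : ℕ}

variable (n) in
/-- The exponents of degree `n` of monomials divisible by some `x_i x_j` with `0 < i, j < a`. -/
def monTarget : Set (Fin (a + 1) →₀ ℕ) :=
  {μ | μ.degree = n ∧ ∃ i j : Fin (a + 1), (i ≠ 0 ∧ (i : ℕ) < a) ∧ (j ≠ 0 ∧ (j : ℕ) < a) ∧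
    Finsupp.single i 1 + Finsupp.single j 1 ≤ μ}

variable (n) in
/-- The exponents of degree `n` of monomials not divisible by any `x_i x_j` with `0 < i, j < a`. -/
def monSource : Set (Fin (a + 1) →₀ ℕ) := {μ | μ.degree = n} \ monTarget n

/-- The matching from indices in homological degree two to exponents of monomials. -/
def monPartner (i : ENIdx a 2) : Fin (a + 1) →₀ ℕ :=
  i.1 + Finsupp.single (i.2.1 0).succ 1 + Finsupp.single (i.2.1 1).castSucc 1

theorem monPartner_mapsTo : Set.MapsTo monPartner (enSource (a := a) n 2) (monTarget n) := by
  rintro ⟨μ, J, h⟩ ⟨⟨h1, h2, -⟩, -⟩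
  have h01 : J 0 < J 1 := h2 (by simp)
  have h01' : (J 0 : ℕ) < J 1 := h01
  refine ⟨?_, (J 0).succ, (J 1).castSucc, ⟨Fin.succ_ne_zero _, ?_⟩, ⟨?_, (J 1).2⟩, ?_⟩
  · simp only [monPartner, degree_add_single]
    exact h1
  · have := (J 1).2
    rw [Fin.val_succ]
    omega
  · intro h0
    have := congrArg Fin.val h0
    simp only [Fin.val_castSucc, Fin.val_zero] at this
    omega
  · rw [monPartner, add_assoc]
    exact le_add_self

theorem exists_monPartner_eq {μ : Fin (a + 1) →₀ ℕ} (hμ : μ ∈ monTarget n) :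
    ∃ i ∈ enSource n 2, monPartner i = μ := by
  obtain ⟨hdeg, p, p', hp, hp', hpp⟩ := hμ
  have hpμ : μ p ≠ 0 := by
    have := hpp p
    rw [Finsupp.add_apply, Finsupp.single_eq_same] at this
    omega
  let s : Set (Fin (a + 1)) := {i | (i ≠ 0 ∧ (i : ℕ) < a) ∧ μ i ≠ 0}
  obtain ⟨i, ⟨hi, hiμ⟩, hmin⟩ := Set.exists_min_image s id (Set.toFinite _) ⟨p, hp, hpμ⟩
  obtain ⟨j, ⟨hj, hjμ⟩, hmax⟩ := Set.exists_max_image s id (Set.toFinite _) ⟨p, hp, hpμ⟩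
  have hp'μ : μ p' ≠ 0 := by
    have := hpp p'
    rw [Finsupp.add_apply, Finsupp.single_eq_same] at this
    omega
  have hij : i ≤ j := (hmin p ⟨hp, hpμ⟩).trans (hmax p ⟨hp, hpμ⟩)
  have hle : Finsupp.single i 1 + Finsupp.single j 1 ≤ μ := by
    rcases hij.eq_or_lt with rfl | hlt
    · have e : p = i := le_antisymm (hmax p ⟨hp, hpμ⟩) (hmin p ⟨hp, hpμ⟩)
      have e' : p' = i := le_antisymm (hmax p' ⟨hp', hp'μ⟩) (hmin p' ⟨hp', hp'μ⟩)
      rwa [e, e'] at hpp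
    · intro l
      rw [Finsupp.add_apply, Finsupp.single_apply, Finsupp.single_apply]
      by_cases hil : i = l
      · subst hil
        rw [if_pos rfl, if_neg hlt.ne']
        omega
      · rw [if_neg hil]
        split_ifs with hjl
        · subst hjl
          omega
        · omega
  have hi1 : 1 ≤ (i : ℕ) := Nat.one_le_iff_ne_zero.2 fun h0 => hi.1 (Fin.ext h0)
  have hij' : (i : ℕ) ≤ j := hij
  let y : Fin a := ⟨i - 1, by omega⟩
  let z : Fin a := ⟨j, hj.2⟩
  have hy : y.succ = i := by
    ext
    simp only [y, Fin.val_succ]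
    omega
  have hsub : μ - (Finsupp.single i 1 + Finsupp.single j 1) + Finsupp.single i 1 +
      Finsupp.single j 1 = μ := by
    rw [add_assoc]
    exact tsub_add_cancel_of_le hle
  have hle' : ∀ l, (μ - (Finsupp.single i 1 + Finsupp.single j 1) : Fin (a + 1) →₀ ℕ) l ≠ 0 →
      μ l ≠ 0 := by
    intro l hl h0
    apply hl
    rw [Finsupp.tsub_apply, h0, Nat.zero_sub]
  have hd := congrArg Finsupp.degree hsub
  rw [degree_add_single, degree_add_single] at hd
  refine ⟨(μ - (Finsupp.single i 1 + Finsupp.single j 1), ![y, z], 1),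
    ⟨⟨?_, ?_, le_rfl, le_rfl⟩, ?_⟩, ?_⟩
  · simp only
    omega
  · refine Fin.strictMono_iff_lt_succ.2 fun t => ?_
    rw [Fin.fin_one_eq_zero t]
    change (i : ℕ) - 1 < j
    omega
  · rintro ⟨-, ⟨l, hl0, hlμ, hlJ⟩ | ⟨-, l, hl0, hlμ, hlJ⟩⟩
    · have hl1 : (l : ℕ) ≤ i - 1 := hlJ 0
      have : (i : ℕ) ≤ l := hmin l ⟨⟨hl0, by omega⟩, hle' l hlμ⟩
      omega
    · have hl1 : (j : ℕ) < l := hlJ 1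
      have : (l : ℕ) ≤ j := hmax l ⟨⟨by rintro rfl; simp at hl1, hl0⟩, hle' l hlμ⟩
      omega
  · simp only [monPartner, Matrix.cons_val_zero, Matrix.cons_val_one, hy]
    exact hsub

theorem monPartner_injOn : Set.InjOn monPartner (enSource (a := a) n 2) := by
  have hfirst : ∀ {μ ν : Fin (a + 1) →₀ ℕ} {J K : Fin 2 → Fin a} {h : ℕ},
      StrictMono J → ¬ enLow (μ, J, h) →
      μ + Finsupp.single (J 0).succ 1 + Finsupp.single (J 1).castSucc 1 =
        ν + Finsupp.single (K 0).succ 1 + Finsupp.single (K 1).castSucc 1 → J 0 ≤ K 0 := by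
    intro μ ν J K h hJ hlow heq
    by_contra! hlt
    have h01 : J 0 < J 1 := hJ (by simp)
    have := DFunLike.congr_fun heq (K 0).succ
    simp only [Finsupp.add_apply, Finsupp.single_apply, Fin.ext_iff, Fin.val_succ,
      Fin.val_castSucc, Fin.lt_def, if_true] at this hlt h01
    rw [if_neg (by omega), if_neg (by omega)] at this
    refine hlow ⟨(K 0).succ, Fin.succ_ne_zero _, ?_, fun t => ?_⟩
    · simp only
      omega
    · exact lt_of_lt_of_le (by exact hlt) (hJ.monotone (Fin.zero_le t))
  have hlast : ∀ {μ ν : Fin (a + 1) →₀ ℕ} {J K : Fin 2 → Fin a} {h : ℕ},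
      StrictMono J → ¬ enHigh (μ, J, h) →
      μ + Finsupp.single (J 0).succ 1 + Finsupp.single (J 1).castSucc 1 =
        ν + Finsupp.single (K 0).succ 1 + Finsupp.single (K 1).castSucc 1 → K 1 ≤ J 1 := by
    intro μ ν J K h hJ hhigh heq
    by_contra! hlt
    have h01 : J 0 < J 1 := hJ (by simp)
    have := DFunLike.congr_fun heq (K 1).castSucc
    simp only [Finsupp.add_apply, Finsupp.single_apply, Fin.ext_iff, Fin.val_succ,
      Fin.val_castSucc, Fin.lt_def, if_true] at this hlt h01
    rw [if_neg (by omega), if_neg (by omega)] at this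
    refine hhigh ⟨(K 1).castSucc, (K 1).2, ?_, fun t => ?_⟩
    · simp only
      omega
    · exact lt_of_le_of_lt (hJ.monotone (Fin.le_last t)) hlt
  rintro ⟨μ, J, h⟩ ⟨hv, h5⟩ ⟨ν, K, l⟩ ⟨hv', h5'⟩ heq
  have hh : h = 1 := le_antisymm (Nat.le_of_succ_le_succ hv.2.2.2) hv.2.2.1
  have hl : l = 1 := le_antisymm (Nat.le_of_succ_le_succ hv'.2.2.2) hv'.2.2.1
  have hlow : ¬ enLow (μ, J, h) := fun H => h5 ⟨hv, Or.inl H⟩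
  have hlow' : ¬ enLow (ν, K, l) := fun H => h5' ⟨hv', Or.inl H⟩
  have hhigh : ¬ enHigh (μ, J, h) := fun H => h5 ⟨hv, Or.inr ⟨by simp [hh], H⟩⟩
  have hhigh' : ¬ enHigh (ν, K, l) := fun H => h5' ⟨hv', Or.inr ⟨by simp [hl], H⟩⟩
  have e0 : J 0 = K 0 :=
    le_antisymm (hfirst hv.2.1 hlow heq) (hfirst hv'.2.1 hlow' heq.symm)
  have e1 : J 1 = K 1 :=
    le_antisymm (hlast hv'.2.1 hhigh' heq.symm) (hlast hv.2.1 hhigh heq)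
  have e2 : J = K := funext fun t => by
    fin_cases t
    · exact e0
    · exact e1
  simp only [monPartner, e0, e1] at heq
  rw [add_right_cancel (add_right_cancel heq), e2, hh, hl]

theorem neg_one_smul_sub_sub_mem {M : Type*} [AddCommGroup M] [Module k M]
    {N : Submodule k M} {x y : M} (hx : x ∈ N) : x - y - (-1 : k) • y ∈ N := by
  rwa [neg_one_smul, sub_neg_eq_add, sub_add_cancel]

theorem IsENQuad.triangular {d : ENTerm k a n 2 →ₗ[k] SU k a (n : ℤ)} (hd : IsENQuad d)
    (i : ENIdx a 2) (hi : i ∈ enSource n 2) :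
    ∃ u : k, u ≠ 0 ∧ d (enVec k n 2 i) - u • monSU k (n : ℤ) (monPartner i) ∈
      Submodule.span k (monSU k (n : ℤ) '' (monSource n ∪
        {μ ∈ monTarget n | monWeight μ < monWeight (monPartner i)})) := by
  obtain ⟨μ, J, h⟩ := i
  obtain ⟨⟨h1, h2, h3, h4⟩, -⟩ := hi
  simp only at h1 h2 h3 h4
  obtain rfl : h = 1 := by omega
  refine ⟨-1, by simp, ?_⟩
  rw [hd.apply_enVec μ J h1]
  refine neg_one_smul_sub_sub_mem (Submodule.subset_span ⟨_, ?_, rfl⟩)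
  by_cases hT : μ + Finsupp.single (J 0).castSucc 1 + Finsupp.single (J 1).succ 1 ∈ monTarget n
  · refine Or.inr ⟨hT, ?_⟩
    have h01 : J 0 < J 1 := h2 (by simp)
    have h01' : (J 0 : ℕ) < J 1 := h01
    have := (J 1).2
    simp only [monPartner, monWeight_add_single, Fin.val_succ, Fin.val_castSucc, varWeight_succ]
    omega
  · refine Or.inl ⟨?_, hT⟩
    simp only [Set.mem_ofPred_eq, degree_add_single]
    exact h1

/-- The sum of the indices of the variables of a monomial. -/
def indexSum (μ : Fin (a + 1) →₀ ℕ) : ℕ := ∑ i : Fin (a + 1), (i : ℕ) * μ i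

theorem indexSum_add (μ ν : Fin (a + 1) →₀ ℕ) : indexSum (μ + ν) = indexSum μ + indexSum ν := by
  simp [indexSum, mul_add, Finset.sum_add_distrib]

theorem indexSum_single (i : Fin (a + 1)) (m : ℕ) : indexSum (Finsupp.single i m) = i * m := by
  simp [indexSum, Finsupp.single_apply]

theorem indexSum_le (μ : Fin (a + 1) →₀ ℕ) : indexSum μ ≤ μ.degree * a := by
  rw [indexSum, Finsupp.degree_eq_sum, Finset.sum_mul]
  refine Finset.sum_le_sum fun i _ => ?_
  rw [mul_comm]
  exact Nat.mul_le_mul_left _ (Nat.lt_succ_iff.1 i.2)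

variable (a n) in
/-- The exponent of degree `n` and index sum `s` supported on `0`, `a` and at most one further
variable. -/
def normalMon (s : ℕ) : Fin (a + 1) →₀ ℕ :=
  if s = n * a then Finsupp.single (Fin.last a) n
  else Finsupp.single 0 (n - 1 - s / a) + Finsupp.single (Fin.ofNat (a + 1) (s % a)) 1 +
    Finsupp.single (Fin.last a) (s / a)

theorem degree_normalMon {s : ℕ} (hs : s ≤ n * a) : (normalMon a n s).degree = n := by
  rw [normalMon]
  split_ifs with h
  · rw [Finsupp.degree_single]
  · have : s / a < n := Nat.div_lt_of_lt_mul (by rw [mul_comm]; omega)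
    rw [map_add, map_add, Finsupp.degree_single, Finsupp.degree_single, Finsupp.degree_single]
    omega

theorem indexSum_normalMon (ha : 0 < a) (s : ℕ) : indexSum (normalMon a n s) = s := by
  rw [normalMon]
  split_ifs with h
  · rw [indexSum_single, Fin.val_last, h, mul_comm]
  · have := Nat.mod_lt s ha
    rw [indexSum_add, indexSum_add, indexSum_single, indexSum_single, indexSum_single,
      Fin.val_ofNat, Nat.mod_eq_of_lt (by omega), Fin.val_zero, Fin.val_last, zero_mul, zero_add,
      mul_one]
    exact Nat.mod_add_div s a

theorem eq_normalMon (ha : 0 < a) {μ : Fin (a + 1) →₀ ℕ} (hμ : μ ∈ monSource n) :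
    μ = normalMon a n (indexSum μ) := by
  obtain ⟨hdeg, hT⟩ := hμ
  simp only [Set.mem_ofPred_eq] at hdeg
  have h0a : (0 : Fin (a + 1)) ≠ Fin.last a := by
    intro h
    have := congrArg Fin.val h
    simp only [Fin.val_zero, Fin.val_last] at this
    omega
  have hlt : ∀ j : Fin (a + 1), j ≠ Fin.last a → (j : ℕ) < a := fun j hj =>
    Fin.val_lt_last hj
  by_cases hmid : ∃ l : Fin (a + 1), (l ≠ 0 ∧ (l : ℕ) < a) ∧ μ l ≠ 0
  · obtain ⟨l, hl, hlμ⟩ := hmid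
    have hla : l ≠ Fin.last a := by
      rintro rfl
      simp at hl
    have hl1 : μ l = 1 := by
      by_contra hne
      refine hT ⟨hdeg, l, l, hl, hl, ?_⟩
      rw [← Finsupp.single_add, Finsupp.single_le_iff]
      omega
    have hother : ∀ j, j ≠ 0 → j ≠ Fin.last a → j ≠ l → μ j = 0 := by
      intro j hj0 hja hjl
      by_contra hne
      refine hT ⟨hdeg, l, j, hl, ⟨hj0, hlt j hja⟩, fun i => ?_⟩
      rw [Finsupp.add_apply, Finsupp.single_apply, Finsupp.single_apply]
      by_cases hil : l = i
      · subst hil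
        rw [if_pos rfl, if_neg hjl]
        omega
      · rw [if_neg hil]
        split_ifs with hij
        · subst hij
          omega
        · omega
    have hμ : μ = Finsupp.single 0 (μ 0) + Finsupp.single l 1 +
        Finsupp.single (Fin.last a) (μ (Fin.last a)) := by
      ext j
      rw [Finsupp.add_apply, Finsupp.add_apply, Finsupp.single_apply, Finsupp.single_apply,
        Finsupp.single_apply]
      by_cases hj0 : j = 0
      · subst hj0
        simp [h0a.symm, hl.1]
      · by_cases hja : j = Fin.last a
        · subst hja
          simp [h0a, hla]
        · by_cases hjl : j = l
          · subst hjl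
            simp [Ne.symm hj0, Ne.symm hja, hl1]
          · simp [Ne.symm hj0, Ne.symm hja, Ne.symm hjl, hother j hj0 hja hjl]
    generalize μ 0 = p at hμ
    generalize μ (Fin.last a) = r at hμ
    subst hμ
    have hs : indexSum (Finsupp.single 0 p + Finsupp.single l 1 +
        Finsupp.single (Fin.last a) r) = l + a * r := by
      rw [indexSum_add, indexSum_add, indexSum_single, indexSum_single, indexSum_single,
        Fin.val_zero, Fin.val_last]
      ring
    rw [map_add, map_add, Finsupp.degree_single, Finsupp.degree_single,
      Finsupp.degree_single] at hdeg
    have hdiv : (l + a * r) / a = r := by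
      rw [Nat.add_mul_div_left _ _ ha, Nat.div_eq_of_lt hl.2, zero_add]
    have hmod : (l + a * r) % a = l := by
      rw [Nat.add_mul_mod_self_left, Nat.mod_eq_of_lt hl.2]
    have hne : (l + a * r : ℕ) ≠ n * a := by
      intro h
      rw [h, Nat.mul_div_cancel _ ha] at hdiv
      omega
    rw [hs, normalMon, if_neg hne, hdiv, hmod, Fin.ofNat_val_eq_self,
      show n - 1 - r = p by omega]
  · have hother : ∀ j, j ≠ 0 → j ≠ Fin.last a → μ j = 0 := fun j hj0 hja => by
      by_contra hne
      exact hmid ⟨j, ⟨hj0, hlt j hja⟩, hne⟩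
    have hμ : μ = Finsupp.single 0 (μ 0) + Finsupp.single (Fin.last a) (μ (Fin.last a)) := by
      ext j
      rw [Finsupp.add_apply, Finsupp.single_apply, Finsupp.single_apply]
      by_cases hj0 : j = 0
      · subst hj0
        simp [h0a.symm]
      · by_cases hja : j = Fin.last a
        · subst hja
          simp [h0a]
        · simp [Ne.symm hj0, Ne.symm hja, hother j hj0 hja]
    generalize μ 0 = p at hμ
    generalize μ (Fin.last a) = r at hμ
    subst hμ
    rw [map_add, Finsupp.degree_single, Finsupp.degree_single] at hdeg
    have hs : indexSum (Finsupp.single 0 p + Finsupp.single (Fin.last a) r) = a * r := by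
      rw [indexSum_add, indexSum_single, indexSum_single, Fin.val_zero, Fin.val_last]
      ring
    rw [hs, normalMon]
    split_ifs with h
    · rw [mul_comm, Nat.mul_right_cancel_iff ha] at h
      rw [← h, show p = 0 by omega, Finsupp.single_zero, zero_add]
    · have hp : p ≠ 0 := by
        rintro rfl
        rw [zero_add] at hdeg
        exact h (by rw [hdeg, mul_comm])
      rw [Nat.mul_div_cancel_left _ ha, Nat.mul_mod_right]
      have : Fin.ofNat (a + 1) 0 = 0 := rfl
      rw [this, ← Finsupp.single_add, show n - 1 - r + 1 = p by omega]

/-- The formula for the projection `π` on monomials. -/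
def IsENProj (π : SU k a (n : ℤ) →ₗ[k] (Fin (n * a + 1) → k)) : Prop :=
  ∀ μ : Fin (a + 1) →₀ ℕ, μ.degree = n → π (monSU k n μ) = wW k (n * a) (indexSum μ)

theorem IsENProj.surjective (ha : 0 < a) {π : SU k a (n : ℤ) →ₗ[k] (Fin (n * a + 1) → k)}
    (hπ : IsENProj π) : Function.Surjective π := by
  rw [← LinearMap.range_eq_top, eq_top_iff, ← (Pi.basisFun k (Fin (n * a + 1))).span_eq,
    Submodule.span_le]
  rintro _ ⟨s, rfl⟩
  have hs : (s : ℕ) ≤ n * a := Nat.lt_succ_iff.1 s.2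
  refine ⟨monSU k n (normalMon a n s), ?_⟩
  rw [hπ _ (degree_normalMon hs), indexSum_normalMon ha, wW, dif_pos hs, Pi.basisFun_apply]

theorem IsENProj.comp_eq_zero {π : SU k a (n : ℤ) →ₗ[k] (Fin (n * a + 1) → k)} (hπ : IsENProj π)
    {d : ENTerm k a n 2 →ₗ[k] SU k a (n : ℤ)} (hd : IsENQuad d) : π ∘ₗ d = 0 := by
  refine LinearMap.ext_on (span_enVec a 2) ?_
  rintro _ ⟨⟨μ, J, h⟩, ⟨h1, -, h3, h4⟩, rfl⟩
  simp only at h1 h3 h4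
  obtain rfl : h = 1 := by omega
  rw [LinearMap.comp_apply, LinearMap.zero_apply, hd.apply_enVec μ J h1, map_sub,
    hπ _ (by simpa only [degree_add_single] using h1),
    hπ _ (by simpa only [degree_add_single] using h1), sub_eq_zero]
  congr 1
  simp only [indexSum_add, indexSum_single, Fin.val_succ, Fin.val_castSucc]
  ring

theorem proj_wW {M s t : ℕ} (hs : s ≤ M) (ht : t ≤ M) :
    wW k M t (Fin.ofNat (M + 1) s) = if t = s then 1 else 0 := by
  rw [wW, dif_pos ht, Pi.single_apply]
  refine if_congr ?_ rfl rfl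
  rw [Fin.ext_iff, Fin.val_ofNat, Nat.mod_eq_of_lt (by omega), eq_comm]

theorem IsENProj.eq_zero_of_mem_span (ha : 0 < a)
    {π : SU k a (n : ℤ) →ₗ[k] (Fin (n * a + 1) → k)} (hπ : IsENProj π) (v : SU k a (n : ℤ))
    (hv : v ∈ Submodule.span k (monSU k (n : ℤ) '' monSource n)) (h0 : π v = 0) : v = 0 := by
  refine eq_zero_of_mem_span_of_triangular π (monSU k (n : ℤ)) (wW k (n * a)) (monSource n)
    {s | s ≤ n * a} {s | s ≤ n * a} (fun s => LinearMap.proj (Fin.ofNat (n * a + 1) s)) indexSum id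
    ?_ ?_ subset_rfl ?_ ?_ ?_ hv h0
  · intro s hs
    rw [LinearMap.proj_apply, proj_wW hs hs, if_pos rfl]
  · intro s hs t ht hne
    rw [LinearMap.proj_apply, proj_wW hs ht, if_neg hne.symm]
  · intro μ hμ
    have hdeg : μ.degree = n := hμ.1
    exact hdeg ▸ indexSum_le μ
  · intro μ hμ ν hν h
    rw [eq_normalMon ha hμ, eq_normalMon ha hν, h]
  · intro μ hμ
    refine ⟨1, one_ne_zero, ?_⟩
    rw [hπ μ hμ.1, one_smul, sub_self]
    exact Submodule.zero_mem _

theorem IsENProj.ker_eq_range (ha : 0 < a) {π : SU k a (n : ℤ) →ₗ[k] (Fin (n * a + 1) → k)}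
    (hπ : IsENProj π) {d : ENTerm k a n 2 →ₗ[k] SU k a (n : ℤ)} (hd : IsENQuad d) :
    LinearMap.ker π = LinearMap.range d := by
  refine ker_eq_range_of_sup_eq_top d π (hπ.comp_eq_zero hd) _ ?_ (hπ.eq_zero_of_mem_span ha)
  refine range_sup_span_eq_top d (monSU k (n : ℤ)) (monSource n) (monTarget n) monWeight ?_ ?_
  · rw [monSource, Set.sdiff_union_of_subset fun μ hμ => hμ.1]
    simpa only [Nat.cast_inj] using span_monSU (k := k) a (n : ℤ)
  · intro μ hμ
    obtain ⟨i, hi, rfl⟩ := exists_monPartner_eq hμ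
    obtain ⟨u, hu, hmem⟩ := hd.triangular i hi
    exact ⟨_, u, hu, hmem⟩

theorem IsENQuad.eq_zero_of_mem_span {d : ENTerm k a n 2 →ₗ[k] SU k a (n : ℤ)} (hd : IsENQuad d)
    (v : ENTerm k a n 2) (hv : v ∈ Submodule.span k (enVec k n 2 '' enSource n 2))
    (h0 : d v = 0) : v = 0 := by
  refine eq_zero_of_mem_span_of_triangular d (enVec k n 2) (monSU k (n : ℤ)) (enSource n 2)
    {μ | μ.degree = n} (monTarget n) (coeffSU a n) monPartner monWeight
    ?_ ?_ (fun μ hμ => hμ.1) monPartner_mapsTo monPartner_injOn hd.triangular hv h0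
  · intro μ hμ
    rw [coeffSU_monSU a _ _ (by exact_mod_cast hμ), if_pos rfl]
  · intro μ _ ν hν hne
    rw [coeffSU_monSU a _ _ (by exact_mod_cast hν), if_neg hne.symm]

end LowDegree

section Exactness

variable {k : Type*} [Field k] {a n q : ℕ}

theorem IsENDiff.range_sup_span_eq_top
    {d : ENTerm k a n (q + 1 + 1) →ₗ[k] ENTerm k a n (q + 1)} (hd : IsENDiff (q + 1) d) :
    LinearMap.range d ⊔ Submodule.span k (enVec k n (q + 1) '' enSource n (q + 1)) = ⊤ := by
  refine _root_.range_sup_span_eq_top d (enVec k n (q + 1)) (enSource n (q + 1))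
    (enTarget n (q + 1)) enRank ?_ ?_
  · rw [enSource, Set.sdiff_union_of_subset fun i hi => hi.1]
    exact span_enVec a (q + 1)
  · intro j hj
    obtain ⟨i, hi, rfl⟩ := exists_enPartner_eq hj
    obtain ⟨u, hu, hmem⟩ := hd.triangular i hi
    exact ⟨_, u, hu, hmem⟩

theorem IsENDiff.eq_zero_of_mem_span (hq : 1 ≤ q)
    {d : ENTerm k a n (q + 1 + 1) →ₗ[k] ENTerm k a n (q + 1)} (hd : IsENDiff (q + 1) d)
    (v : ENTerm k a n (q + 1 + 1))
    (hv : v ∈ Submodule.span k (enVec k n (q + 1 + 1) '' enSource n (q + 1 + 1)))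
    (h0 : d v = 0) : v = 0 :=
  eq_zero_of_mem_span_of_triangular d (enVec k n (q + 1 + 1)) (enVec k n (q + 1))
    (enSource n (q + 1 + 1)) (enValid n (q + 1)) (enTarget n (q + 1)) (enDual k a n (q + 1))
    enPartner enRank (enDual_self a (q + 1)) (enDual_of_ne a (q + 1)) (fun _ hi => hi.1)
    (enPartner_mapsTo hq) enPartner_injOn hd.triangular hv h0

theorem IsENQuad.ker_eq_range {d : ENTerm k a n 2 →ₗ[k] SU k a (n : ℤ)} (hd : IsENQuad d)
    {d' : ENTerm k a n (2 + 1) →ₗ[k] ENTerm k a n 2} (hd' : IsENDiff 2 d') :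
    LinearMap.ker d = LinearMap.range d' :=
  ker_eq_range_of_sup_eq_top d' d (hd.comp_eq_zero hd') _
    (IsENDiff.range_sup_span_eq_top (q := 1) hd') hd.eq_zero_of_mem_span

theorem IsENDiff.ker_eq_range (hq : 1 ≤ q)
    {d : ENTerm k a n (q + 1 + 1) →ₗ[k] ENTerm k a n (q + 1)} (hd : IsENDiff (q + 1) d)
    {d' : ENTerm k a n (q + 1 + 1 + 1) →ₗ[k] ENTerm k a n (q + 1 + 1)}
    (hd' : IsENDiff (q + 1 + 1) d') : LinearMap.ker d = LinearMap.range d' :=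
  ker_eq_range_of_sup_eq_top d' d (hd.comp_eq_zero hd') _ hd'.range_sup_span_eq_top
    (hd.eq_zero_of_mem_span hq)

end Exactness

/-- The degree-`n` part of the relative (Eagon–Northcott) resolution
`S^{n−a}U ⊗ Λ^a G_a ⊗ G_{a−1} → ⋯ → S^{n−2}U ⊗ Λ² G_a ⊗ G_1 → S^n U → W_{na} → 0`
is exact: `π` is surjective, `ker π = im d_2`, and `ker d_q = im d_{q+1}` for `2 ≤ q ≤ a−1`.

The maps are specified on basis elements:
* `π` sends a monomial `x_{i_1}⋯x_{i_n}` to `w_{i_1+⋯+i_n}`;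
* `d_2` sends `m ⊗ g_{j_1}∧g_{j_2} ⊗ g_1` to `(x_{j_1−1}x_{j_2} − x_{j_1}x_{j_2−1})·m`;
* for `3 ≤ q ≤ a`, `d_q` (called `D q` below) sends `m ⊗ g_{j_1}∧⋯∧g_{j_q} ⊗ g_h` to
  `Σ_t (−1)^t (x_{j_t−1}·m ⊗ ⋯∧ĝ_{j_t}∧⋯ ⊗ g_{h−1} − x_{j_t}·m ⊗ ⋯∧ĝ_{j_t}∧⋯ ⊗ g_h)`,
where `g`-indices are 1-based (`g_j ↔ x_{j-1}, x_j` with `j ∈ {1,…,a}`). -/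
theorem eagonNorthcott_degree_part_exact (k : Type*) [Field k] (a : ℕ) (ha : 2 ≤ a) (n : ℕ)
    (π : SU k a (n : ℤ) →ₗ[k] (Fin (n * a + 1) → k))
    (hπ : ∀ (d : Fin (a + 1) →₀ ℕ) (hd : d.degree = n),
      π ⟨MvPolynomial.monomial d 1, monMemSU hd⟩ =
        wW k (n * a) (∑ i : Fin (a + 1), (i : ℕ) * d i))
    (d2 : ((SU k a ((n : ℤ) - 2) ⊗[k] ⋀[k]^2 (Fin a → k)) ⊗[k] (Fin 1 → k)) →ₗ[k]
      SU k a (n : ℤ))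
    (hd2 : ∀ (m : SU k a ((n : ℤ) - 2)) (J : Fin 2 → Fin a),
      d2 ((m ⊗ₜ[k] wedge k 2 (fun t => Pi.single (J t) 1)) ⊗ₜ[k] Pi.single 0 1) =
        ⟨(X (J 0).castSucc * X (J 1).succ - X (J 0).succ * X (J 1).castSucc) *
            (m : MvPolynomial (Fin (a + 1)) k),
          quadMulSU (J 0).castSucc (J 1).succ (J 0).succ (J 1).castSucc m.2⟩)
    (D : ∀ q : ℕ, ((SU k a ((n : ℤ) - q) ⊗[k] ⋀[k]^q (Fin a → k)) ⊗[k] (Fin (q - 1) → k)) →ₗ[k]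
      ((SU k a ((n : ℤ) - (q - 1 : ℕ)) ⊗[k] ⋀[k]^(q - 1) (Fin a → k)) ⊗[k] (Fin (q - 2) → k)))
    (hD : ∀ (q : ℕ) (hq3 : 3 ≤ q) (hqa : q ≤ a) (m : SU k a ((n : ℤ) - q)) (J : Fin q → Fin a) (h : ℤ),
      D q ((m ⊗ₜ[k] wedge k q (fun t => Pi.single (J t) 1)) ⊗ₜ[k] gG k (q - 1) h) =
        ∑ t : Fin q, ((-1 : k) ^ ((t : ℕ) + 1)) •
          (((⟨X (J t).castSucc * (m : MvPolynomial (Fin (a + 1)) k),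
                xMulSU (J t).castSucc (by omega) m.2⟩ ⊗ₜ[k]
              wedge k (q - 1) (fun s => Pi.single (J (skipAt t s)) 1)) ⊗ₜ[k]
              gG k (q - 2) (h - 1))
            - ((⟨X (J t).succ * (m : MvPolynomial (Fin (a + 1)) k),
                xMulSU (J t).succ (by omega) m.2⟩ ⊗ₜ[k]
              wedge k (q - 1) (fun s => Pi.single (J (skipAt t s)) 1)) ⊗ₜ[k]
              gG k (q - 2) h))) :
    Function.Surjective π ∧
    LinearMap.ker π = LinearMap.range d2 ∧
    (3 ≤ a → LinearMap.ker d2 = LinearMap.range (D 3)) ∧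
    (∀ q : ℕ, 3 ≤ q → q ≤ a - 1 → LinearMap.ker (D q) = LinearMap.range (D (q + 1))) := by
  have hproj : IsENProj π := fun μ hμ => by
    rw [monSU, dif_pos (congrArg Nat.cast hμ)]
    exact hπ μ hμ
  have hquad : IsENQuad (k := k) (a := a) (n := n) d2 := fun m J => by
    have hg : gG k (2 - 1) 1 = Pi.single 0 1 := rfl
    rw [hg]
    exact congrArg Subtype.val (hd2 m J)
  have hdiff : ∀ q, 2 ≤ q → q + 1 ≤ a → IsENDiff (k := k) (a := a) (n := n) q (D (q + 1)) := by
    intro q hq hqa m J h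
    have hskip : ∀ (t : Fin (q + 1)) (s : Fin q), t.succAbove s = skipAt t s := by
      intro t s
      ext
      simp only [Fin.succAbove, skipAt, Fin.lt_def, Fin.val_castSucc]
      split_ifs <;> rfl
    simp only [hskip]
    exact hD (q + 1) (by omega) hqa m J h
  refine ⟨hproj.surjective (by omega), hproj.ker_eq_range (by omega) hquad,
    fun h3 => hquad.ker_eq_range (hdiff 2 le_rfl h3), fun q hq hqa => ?_⟩
  obtain ⟨q, rfl⟩ : ∃ r, q = r + 1 + 1 := ⟨q - 2, by omega⟩
  exact (hdiff (q + 1) (by omega) (by omega)).ker_eq_range (by omega)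
    (hdiff (q + 1 + 1) (by omega) (by omega))

end
end

section
/- Let φ : R → R' be a surjective homomorphism of graded k-algebras such that the degree-1 component φ_1 : R_1 → R'_1 is a k-linear isomorphism. Then for every p ≥ 1 the induced k-linear map K_{p,1}(R) → K_{p,1}(R'), given on representatives by applying id_{Λ^p V} ⊗ φ_1, is well defined and injective. -/
open scoped TensorProduct

set_option maxHeartbeats 1600000
set_option synthInstance.maxHeartbeats 400000
set_option maxSynthPendingDepth 3

noncomputable section

/-- Multiplication `𝒜 1 × 𝒜 q → 𝒜 (q+1)` in a graded algebra. -/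
def gradedMul {k A : Type*} [Field k] [CommRing A] [Algebra k A]
    (𝒜 : ℕ → Submodule k A) [GradedAlgebra 𝒜] {q : ℕ} (v : 𝒜 1) (f : 𝒜 q) : 𝒜 (q + 1) :=
  ⟨(v : A) * (f : A), by
    have h := SetLike.mul_mem_graded v.2 f.2
    rwa [add_comm] at h⟩

/-- Multiplication `𝒜 1 × 𝒜' q → 𝒜' (q+1)` through a graded homomorphism `φ`. -/
def gradedMulMap {k A A' : Type*} [Field k] [CommRing A] [Algebra k A] [CommRing A']
    [Algebra k A'] (𝒜 : ℕ → Submodule k A) (𝒜' : ℕ → Submodule k A') [GradedAlgebra 𝒜']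
    (φ : A →ₐ[k] A') (hgr : ∀ n, ∀ x ∈ 𝒜 n, φ x ∈ 𝒜' n) {q : ℕ}
    (v : 𝒜 1) (f : 𝒜' q) : 𝒜' (q + 1) :=
  ⟨φ (v : A) * (f : A'), by
    have h := SetLike.mul_mem_graded (hgr 1 _ v.2) f.2
    rwa [add_comm] at h⟩

/-- A linear map carrying `K` into `L` and pulling `Q` back to `P` induces an injective map
`K / (K ∩ P) → L / (L ∩ Q)`. -/
theorem exists_injective_quotient_map {k M N : Type*} [Ring k] [AddCommGroup M] [AddCommGroup N]
    [Module k M] [Module k N] (Φ : M →ₗ[k] N) {K P : Submodule k M} {L Q : Submodule k N}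
    (hKL : ∀ x ∈ K, Φ x ∈ L) (hPQ : ∀ x, Φ x ∈ Q ↔ x ∈ P) :
    ∃ F : (K ⧸ Submodule.comap K.subtype P) →ₗ[k] (L ⧸ Submodule.comap L.subtype Q),
      Function.Injective F ∧ ∀ (x : K) (y : L), (y : N) = Φ x →
        F (Submodule.Quotient.mk x) = Submodule.Quotient.mk y := by
  have hcomap : Submodule.comap K.subtype P =
      (Submodule.comap L.subtype Q).comap (Φ.restrict hKL) :=
    Submodule.ext fun x => (hPQ x).symm
  refine ⟨Submodule.mapQ _ _ (Φ.restrict hKL) hcomap.le, ?_, fun x y hxy => ?_⟩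
  · rw [← LinearMap.ker_eq_bot, LinearMap.ker_eq_bot']
    intro x hx
    obtain ⟨x, rfl⟩ := Submodule.Quotient.mk_surjective _ x
    rw [Submodule.mapQ_apply, Submodule.Quotient.mk_eq_zero] at hx
    exact (Submodule.Quotient.mk_eq_zero _).2 (hcomap.ge hx)
  · rw [Submodule.mapQ_apply]
    exact congrArg _ (Subtype.ext hxy.symm)

/-- A graded homomorphism commutes with the Koszul differentials. -/
theorem lTensor_comp_koszul_differential {k A A' : Type*} [Field k]
    [CommRing A] [CommRing A'] [Algebra k A] [Algebra k A']
    {𝒜 : ℕ → Submodule k A} {𝒜' : ℕ → Submodule k A'}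
    [GradedAlgebra 𝒜] [GradedAlgebra 𝒜']
    {φ : A →ₐ[k] A'} (hgr : ∀ n, ∀ x ∈ 𝒜 n, φ x ∈ 𝒜' n) {n q : ℕ}
    {d : ((⋀[k]^(n+1) (𝒜 1)) ⊗[k] (𝒜 q)) →ₗ[k] ((⋀[k]^n (𝒜 1)) ⊗[k] (𝒜 (q+1)))}
    (hd : ∀ (v : Fin (n+1) → 𝒜 1) (f : 𝒜 q),
      d (wedge k (n+1) v ⊗ₜ[k] f) =
        ∑ i : Fin (n+1), ((-1:k)^(i:ℕ)) •
          (wedge k n (fun j => v (i.succAbove j)) ⊗ₜ[k] gradedMul 𝒜 (v i) f))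
    {d' : ((⋀[k]^(n+1) (𝒜 1)) ⊗[k] (𝒜' q)) →ₗ[k] ((⋀[k]^n (𝒜 1)) ⊗[k] (𝒜' (q+1)))}
    (hd' : ∀ (v : Fin (n+1) → 𝒜 1) (f : 𝒜' q),
      d' (wedge k (n+1) v ⊗ₜ[k] f) =
        ∑ i : Fin (n+1), ((-1:k)^(i:ℕ)) •
          (wedge k n (fun j => v (i.succAbove j)) ⊗ₜ[k] gradedMulMap 𝒜 𝒜' φ hgr (v i) f)) :
    (φ.toLinearMap.restrict (q := 𝒜' (q+1)) (hgr (q+1))).lTensor (⋀[k]^n (𝒜 1)) ∘ₗ d =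
      d' ∘ₗ (φ.toLinearMap.restrict (q := 𝒜' q) (hgr q)).lTensor (⋀[k]^(n+1) (𝒜 1)) := by
  have hmul (v : 𝒜 1) (f : 𝒜 q) :
      φ.toLinearMap.restrict (q := 𝒜' (q+1)) (hgr (q+1)) (gradedMul 𝒜 v f) =
        gradedMulMap 𝒜 𝒜' φ hgr v (φ.toLinearMap.restrict (q := 𝒜' q) (hgr q) f) :=
    Subtype.ext (map_mul φ (v : A) (f : A))
  apply TensorProduct.ext
  apply exteriorPower.linearMap_ext
  ext v f : 2
  change LinearMap.lTensor _ _ (d (wedge k (n+1) v ⊗ₜ[k] f)) =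
    d' (wedge k (n+1) v ⊗ₜ[k] (φ.toLinearMap.restrict (q := 𝒜' q) (hgr q) f))
  rw [hd, hd', map_sum]
  refine Finset.sum_congr rfl fun i _ => ?_
  rw [map_smul, LinearMap.lTensor_tmul, hmul]

/-- Let `φ : R → R'` be a surjective homomorphism of graded `k`-algebras
(with `R_0 = R'_0 = k` and `R_1` finite dimensional) such that
`φ_1 : R_1 → R'_1` is an isomorphism.  For every `p ≥ 1` (here `p = n+1`) the induced map
`K_{p,1}(R) → K_{p,1}(R')`, given on representatives by `id_{Λ^p V} ⊗ φ_1`, is well defined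
and injective.  Here the Koszul cohomology of both `R` and `R'` is computed with
`V := R_1`, via the structure maps `id : V → R_1` and `φ_1 : V → R'_1` respectively. -/
theorem koszul_K_p1_map_injective (k : Type*) [Field k]
    (A A' : Type*) [CommRing A] [CommRing A'] [Algebra k A] [Algebra k A']
    (𝒜 : ℕ → Submodule k A) (𝒜' : ℕ → Submodule k A')
    [GradedAlgebra 𝒜] [GradedAlgebra 𝒜']
    (h0 : ∀ x ∈ 𝒜 0, ∃ c : k, x = algebraMap k A c)
    (h0' : ∀ x ∈ 𝒜' 0, ∃ c : k, x = algebraMap k A' c)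
    [FiniteDimensional k (𝒜 1)]
    (φ : A →ₐ[k] A') (hφsurj : Function.Surjective φ)
    (hgr : ∀ n, ∀ x ∈ 𝒜 n, φ x ∈ 𝒜' n)
    (hφ1 : Function.Bijective (φ.toLinearMap.restrict (q := 𝒜' 1) (hgr 1)))
    (δ : ∀ n q : ℕ, ((⋀[k]^(n+1) (𝒜 1)) ⊗[k] (𝒜 q)) →ₗ[k] ((⋀[k]^n (𝒜 1)) ⊗[k] (𝒜 (q+1))))
    (hδ : ∀ (n q : ℕ) (v : Fin (n+1) → 𝒜 1) (f : 𝒜 q),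
      δ n q (wedge k (n+1) v ⊗ₜ[k] f) =
        ∑ i : Fin (n+1), ((-1:k)^(i:ℕ)) •
          (wedge k n (fun j => v (i.succAbove j)) ⊗ₜ[k] gradedMul 𝒜 (v i) f))
    (δ' : ∀ n q : ℕ, ((⋀[k]^(n+1) (𝒜 1)) ⊗[k] (𝒜' q)) →ₗ[k] ((⋀[k]^n (𝒜 1)) ⊗[k] (𝒜' (q+1))))
    (hδ' : ∀ (n q : ℕ) (v : Fin (n+1) → 𝒜 1) (f : 𝒜' q),
      δ' n q (wedge k (n+1) v ⊗ₜ[k] f) =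
        ∑ i : Fin (n+1), ((-1:k)^(i:ℕ)) •
          (wedge k n (fun j => v (i.succAbove j)) ⊗ₜ[k] gradedMulMap 𝒜 𝒜' φ hgr (v i) f))
    (p n : ℕ) (hpn : p = n + 1) :
    ∃ F : (LinearMap.ker (δ n 1) ⧸
        Submodule.comap (LinearMap.ker (δ n 1)).subtype (LinearMap.range (δ (n+1) 0))) →ₗ[k]
      (LinearMap.ker (δ' n 1) ⧸
        Submodule.comap (LinearMap.ker (δ' n 1)).subtype (LinearMap.range (δ' (n+1) 0))),
      Function.Injective F ∧
      ∀ (x : LinearMap.ker (δ n 1)) (y : LinearMap.ker (δ' n 1)),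
        (y : (⋀[k]^(n+1) (𝒜 1)) ⊗[k] (𝒜' 1)) =
          LinearMap.lTensor (⋀[k]^(n+1) (𝒜 1))
            (φ.toLinearMap.restrict (q := 𝒜' 1) (hgr 1))
            (x : (⋀[k]^(n+1) (𝒜 1)) ⊗[k] (𝒜 1)) →
        F (Submodule.Quotient.mk x) = Submodule.Quotient.mk y := by
  have hcomm (m q : ℕ) := LinearMap.congr_fun
    (lTensor_comp_koszul_differential hgr (hδ m q) (hδ' m q))
  simp only [LinearMap.comp_apply] at hcomm
  have hφ0 : Function.Surjective (φ.toLinearMap.restrict (q := 𝒜' 0) (hgr 0)) := by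
    rintro ⟨x, hx⟩
    obtain ⟨c, rfl⟩ := h0' x hx
    exact ⟨⟨algebraMap k A c, SetLike.algebraMap_mem_graded 𝒜 c⟩, Subtype.ext (φ.commutes c)⟩
  set Φ := LinearMap.lTensor (⋀[k]^(n+1) (𝒜 1)) (φ.toLinearMap.restrict (q := 𝒜' 1) (hgr 1))
  have hΦinj : Function.Injective Φ := Module.Flat.lTensor_preserves_injective_linearMap _ hφ1.1
  have hker : ∀ x ∈ LinearMap.ker (δ n 1), Φ x ∈ LinearMap.ker (δ' n 1) := fun x hx => by
    rw [LinearMap.mem_ker] at hx ⊢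
    rw [← hcomm n 1 x, hx, map_zero]
  have hrange (x : (⋀[k]^(n+1) (𝒜 1)) ⊗[k] (𝒜 1)) :
      Φ x ∈ LinearMap.range (δ' (n+1) 0) ↔ x ∈ LinearMap.range (δ (n+1) 0) := by
    constructor
    · rintro ⟨y, hy⟩
      obtain ⟨z, rfl⟩ := LinearMap.lTensor_surjective (⋀[k]^(n+1+1) (𝒜 1)) hφ0 y
      exact ⟨z, hΦinj ((hcomm (n+1) 0 z).trans hy)⟩
    · rintro ⟨z, rfl⟩
      exact ⟨_, (hcomm (n+1) 0 z).symm⟩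
  exact exists_injective_quotient_map Φ hker hrange

end
end

section
/- Identify V with R_1 by sending the basis vector v_{(i,j)} (for (i,j) ∈ {0,…,a}×{0,…,b}) to the monomial x^i y^{a−i} z^j w^{b−j}, and let I := ker(S²V → R_2) be the kernel of the multiplication map. Then every element α_{S,j} and every element β_j lies in Λ^{p−1}V ⊗ I and is mapped to zero by the k-linear map Λ^{p−1}V ⊗ S²V → Λ^{p−2}V ⊗ S³V sending v_1∧⋯∧v_{p−1} ⊗ q to Σ_{i=1}^{p−1} (−1)^{i+1} v_1∧⋯∧v̂_i∧⋯∧v_{p−1} ⊗ v_i·q. -/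
open MvPolynomial
open scoped TensorProduct

set_option maxHeartbeats 1600000
set_option synthInstance.maxHeartbeats 400000
set_option maxSynthPendingDepth 3

noncomputable section

/-- `desc2 p c1 c2` is the strictly decreasing enumeration `l_1 > l_2 > ⋯ > l_{p−1}`
of the complement of `{c1, c2}` in `{0, …, p}` (for `c1 < c2`). -/
def desc2 (p : ℕ) (c1 c2 : Fin (p + 1)) (t : Fin (p - 1)) : Fin (p + 1) :=
  ⟨if p - 2 - (t : ℕ) < (c1 : ℕ) then p - 2 - (t : ℕ)
   else if p - 2 - (t : ℕ) + 1 < (c2 : ℕ) then p - 2 - (t : ℕ) + 1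
   else p - 2 - (t : ℕ) + 2, by
    have h1 := t.2; have h2 := c1.2; have h3 := c2.2
    split_ifs <;> omega⟩

/-- The element `X_u · X_v − X_{u'} · X_{v'}` of `S²V`. -/
def quadEl (k : Type*) [Field k] {σ : Type*} (u v u' v' : σ) :
    MvPolynomial.homogeneousSubmodule σ k 2 :=
  ⟨X u * X v - X u' * X v', by
    refine Submodule.sub_mem _ ?_ ?_ <;> rw [MvPolynomial.mem_homogeneousSubmodule]
    · exact (MvPolynomial.isHomogeneous_X k u).mul (MvPolynomial.isHomogeneous_X k v)
    · exact (MvPolynomial.isHomogeneous_X k u').mul (MvPolynomial.isHomogeneous_X k v')⟩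

/-- The element `α_{S,j}` of `Λ^{p−1}V ⊗ S²V` attached to an ordered `(p+1)`-tuple
`P_1, …, P_{p+1}` of points of `{0,…,a}×{0,…,b−1}` and an integer `0 ≤ j ≤ p−1`:
the sum over all `(e_1,…,e_{p−1}) ∈ {(0,0),(0,1)}^{p−1}` with `Σe_t = (0,j)` and all
decreasing sequences `p+1 ≥ l_1 > ⋯ > l_{p−1} ≥ 1` (parametrised by the missing pair
`l'_1 < l'_2`) of
`(−1)^{l_1+⋯+l_{p−1}} v_{P_{l_1}+e_1} ∧ ⋯ ∧ v_{P_{l_{p−1}}+e_{p−1}}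
  ⊗ (v_{P_{l'_1}+(0,1)}·v_{P_{l'_2}} − v_{P_{l'_1}}·v_{P_{l'_2}+(0,1)})`. -/
def alphaEl (k : Type*) [Field k] (a b p : ℕ)
    (P : Fin (p + 1) → Fin (a + 1) × Fin b) (j : ℕ) :
    (⋀[k]^(p-1) ((Fin (a + 1) × Fin (b + 1)) → k)) ⊗[k]
      (MvPolynomial.homogeneousSubmodule (Fin (a + 1) × Fin (b + 1)) k 2) :=
  ∑ e : Fin (p - 1) → Bool, ∑ c : Fin (p + 1) × Fin (p + 1),
    if (c.1 : ℕ) < (c.2 : ℕ) ∧ (∑ t, (if e t then 1 else 0)) = j then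
      ((-1 : k) ^ (∑ t : Fin (p - 1), ((desc2 p c.1 c.2 t : ℕ) + 1))) •
        (wedge k (p - 1) (fun t =>
            Pi.single ((P (desc2 p c.1 c.2 t)).1,
              if e t then (P (desc2 p c.1 c.2 t)).2.succ
                else (P (desc2 p c.1 c.2 t)).2.castSucc) 1)
          ⊗ₜ[k] quadEl k ((P c.1).1, (P c.1).2.succ) ((P c.2).1, (P c.2).2.castSucc)
              ((P c.1).1, (P c.1).2.castSucc) ((P c.2).1, (P c.2).2.succ))
    else 0

/-- The element `β_j` of `Λ^{p−1}V ⊗ S²V` attached to an enumeration `Q_1, …, Q_{p+1}` of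
the points of `{0,…,a−1}×{0,…,b}` and an integer `0 ≤ j ≤ p−1`, defined like `α_{S,j}`
but with shifts `e_t ∈ {(0,0),(1,0)}`, `Σe_t = (j,0)`, and second factor
`v_{Q_{l'_1}+(1,0)}·v_{Q_{l'_2}} − v_{Q_{l'_1}}·v_{Q_{l'_2}+(1,0)}`. -/
def betaEl (k : Type*) [Field k] (a b p : ℕ)
    (Q : Fin (p + 1) → Fin a × Fin (b + 1)) (j : ℕ) :
    (⋀[k]^(p-1) ((Fin (a + 1) × Fin (b + 1)) → k)) ⊗[k]
      (MvPolynomial.homogeneousSubmodule (Fin (a + 1) × Fin (b + 1)) k 2) :=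
  ∑ e : Fin (p - 1) → Bool, ∑ c : Fin (p + 1) × Fin (p + 1),
    if (c.1 : ℕ) < (c.2 : ℕ) ∧ (∑ t, (if e t then 1 else 0)) = j then
      ((-1 : k) ^ (∑ t : Fin (p - 1), ((desc2 p c.1 c.2 t : ℕ) + 1))) •
        (wedge k (p - 1) (fun t =>
            Pi.single ((if e t then (Q (desc2 p c.1 c.2 t)).1.succ
                else (Q (desc2 p c.1 c.2 t)).1.castSucc),
              (Q (desc2 p c.1 c.2 t)).2) 1)
          ⊗ₜ[k] quadEl k ((Q c.1).1.succ, (Q c.1).2) ((Q c.2).1.castSucc, (Q c.2).2)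
              ((Q c.1).1.castSucc, (Q c.1).2) ((Q c.2).1.succ, (Q c.2).2))
    else 0

/-- The monomial `x^{e 0} y^{e 1} z^{e 2} w^{e 3}` in `k[x,y,z,w]`. -/
def mon4 (k : Type*) [Field k] (e : Fin 4 → ℕ) : MvPolynomial (Fin 4) k :=
  MvPolynomial.monomial (Finsupp.equivFunOnFinite.symm e) 1

/-- The identification of the basis vector `v_{(i,j)}` of `V` with the monomial
`x^i y^{a−i} z^j w^{b−j}` of `R_1`. -/
def segVar (k : Type*) [Field k] (a b : ℕ) (P : Fin (a + 1) × Fin (b + 1)) :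
    MvPolynomial (Fin 4) k :=
  mon4 k ![(P.1 : ℕ), a - (P.1 : ℕ), (P.2 : ℕ), b - (P.2 : ℕ)]

/-- `I = ker (S²V → R_2)`, the space of quadrics vanishing on the Segre–Veronese embedding,
realized inside `S²V`; the multiplication map `S²V → R_2` sends the variable `X_{(i,j)}` to
the monomial `x^i y^{a−i} z^j w^{b−j}`. -/
def Iquad (k : Type*) [Field k] (a b : ℕ) :
    Submodule k (MvPolynomial.homogeneousSubmodule (Fin (a + 1) × Fin (b + 1)) k 2) :=
  Submodule.comap (MvPolynomial.homogeneousSubmodule (Fin (a + 1) × Fin (b + 1)) k 2).subtype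
    (LinearMap.ker (MvPolynomial.aeval (R := k) (segVar k a b)).toLinearMap)

/-- Multiplication of an element of `S^d V` by the variable `X_s`, landing in `S^{d+1} V`. -/
def mulXh (k : Type*) [Field k] {σ : Type*} (s : σ) {d : ℕ}
    (f : MvPolynomial.homogeneousSubmodule σ k d) :
    MvPolynomial.homogeneousSubmodule σ k (d + 1) :=
  ⟨MvPolynomial.X s * (f : MvPolynomial σ k), by
    rw [MvPolynomial.mem_homogeneousSubmodule]
    have h := (MvPolynomial.isHomogeneous_X k s).mul
      ((MvPolynomial.mem_homogeneousSubmodule _ _).mp f.2)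
    rwa [add_comm] at h⟩

/-- `desc2` enumerates the complement of `{c₁, c₂}`. -/
theorem sum_desc2 {M : Type*} [AddCommMonoid M] (m : ℕ) {c₁ c₂ : Fin (m + 3)} (hc : c₁ < c₂)
    (f : Fin (m + 3) → M) :
    ∑ t : Fin (m + 1), f (desc2 (m + 2) c₁ c₂ t) = ∑ x with x ≠ c₁ ∧ x ≠ c₂, f x := by
  have hc' : (c₁ : ℕ) < c₂ := hc
  refine Finset.sum_bij' (fun t _ => desc2 (m + 2) c₁ c₂ t)
    (fun x hx => ⟨if (c₂ : ℕ) < x then m + 2 - x else if (c₁ : ℕ) < x then m + 1 - x else m - x, by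
      simp only [Finset.mem_filter, Finset.mem_univ, true_and, ne_eq, Fin.ext_iff] at hx
      split_ifs <;> omega⟩) ?_ ?_ ?_ ?_ ?_
  · intro t _
    simp only [Finset.mem_filter, Finset.mem_univ, true_and, ne_eq, Fin.ext_iff, desc2]
    split_ifs <;> omega
  · intro x _
    exact Finset.mem_univ _
  · intro t _
    simp only [Fin.ext_iff, desc2]
    split_ifs <;> omega
  · intro x hx
    simp only [Finset.mem_filter, Finset.mem_univ, true_and, ne_eq, Fin.ext_iff] at hx
    simp only [Fin.ext_iff, desc2]
    split_ifs <;> omega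
  · intro t _
    rfl

theorem neg_one_pow_sum_desc2 {R : Type*} [CommRing R] (m : ℕ) {c₁ c₂ : Fin (m + 3)}
    (hc : c₁ < c₂) :
    (-1 : R) ^ (∑ t : Fin (m + 1), ((desc2 (m + 2) c₁ c₂ t : ℕ) + 1)) =
      (-1) ^ (∑ x : Fin (m + 3), ((x : ℕ) + 1)) * (-1) ^ ((c₁ : ℕ) + c₂) := by
  have h := sum_desc2 m hc (fun x => (x : ℕ) + 1)
  have h' : ∑ x : Fin (m + 3), ((x : ℕ) + 1) =
      (∑ x : Fin (m + 3) with x ≠ c₁ ∧ x ≠ c₂, ((x : ℕ) + 1)) + ((c₁ + 1) + (c₂ + 1)) := by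
    rw [← Finset.sum_filter_add_sum_filter_not _ (fun x => x ≠ c₁ ∧ x ≠ c₂)]
    congr 1
    have : (Finset.univ.filter fun x => ¬(x ≠ c₁ ∧ x ≠ c₂)) = {c₁, c₂} := by
      ext x
      simp only [Finset.mem_filter, Finset.mem_univ, true_and, Finset.mem_insert,
        Finset.mem_singleton]
      tauto
    rw [this, Finset.sum_pair hc.ne]
  rw [h, h', ← pow_add]
  have : ∀ s x y : ℕ, s + (x + 1 + (y + 1)) + (x + y) = s + 2 * (x + y + 1) := by intros; ring
  rw [this, pow_add, pow_mul]
  simp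

/-- Choosing a pair `c₁ < c₂` and then a position in the decreasing enumeration of its
complement amounts to choosing a triple `d₁ < d₂ < d₃` and a distinguished element of it. -/
theorem sum_pair_desc2_eq_zero {M : Type*} [AddCommMonoid M] (m : ℕ)
    (g : Fin (m + 3) → Fin (m + 3) → Fin (m + 1) → M)
    (hg : ∀ d₁ d₂ d₃ : Fin (m + 3), d₁ < d₂ → d₂ < d₃ → ∀ i₁ i₂ i₃ : Fin (m + 1),
      (i₃ : ℕ) + d₃ = m + 2 → (i₂ : ℕ) + d₂ = m + 1 → (i₁ : ℕ) + d₁ = m →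
      g d₁ d₂ i₃ + g d₁ d₃ i₂ + g d₂ d₃ i₁ = 0) :
    ∑ c : Fin (m + 3) × Fin (m + 3), (if c.1 < c.2 then ∑ i, g c.1 c.2 i else 0) = 0 := by
  set G : Fin (m + 3) → Fin (m + 3) → ℕ → M :=
    fun c₁ c₂ n => if h : n < m + 1 then g c₁ c₂ ⟨n, h⟩ else 0 with hG
  have key : ∀ c₁ c₂ : Fin (m + 3), (if c₁ < c₂ then ∑ i, g c₁ c₂ i else 0) =
      (∑ x : Fin (m + 3), if c₁ < c₂ ∧ c₂ < x then G c₁ c₂ (m + 2 - x) else 0) +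
      (∑ x : Fin (m + 3), if c₁ < x ∧ x < c₂ then G c₁ c₂ (m + 1 - x) else 0) +
      (∑ x : Fin (m + 3), if x < c₁ ∧ c₁ < c₂ then G c₁ c₂ (m - x) else 0) := by
    intro c₁ c₂
    split_ifs with hc
    · have hc' : (c₁ : ℕ) < c₂ := hc
      rw [← Finset.sum_add_distrib, ← Finset.sum_add_distrib]
      have h := sum_desc2 m hc (fun x => G c₁ c₂
        (if (c₂ : ℕ) < x then m + 2 - x else if (c₁ : ℕ) < x then m + 1 - x else m - x))
      rw [Finset.sum_filter] at h
      refine Eq.trans ?_ (h.trans ?_)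
      · refine Finset.sum_congr rfl fun t _ => ?_
        have ht : (if (c₂ : ℕ) < desc2 (m + 2) c₁ c₂ t then m + 2 - desc2 (m + 2) c₁ c₂ t
            else if (c₁ : ℕ) < desc2 (m + 2) c₁ c₂ t then m + 1 - desc2 (m + 2) c₁ c₂ t
            else m - desc2 (m + 2) c₁ c₂ t : ℕ) = t := by
          simp only [desc2]
          split_ifs <;> omega
        simp only [ht, hG, t.2, dif_pos]
      · refine Finset.sum_congr rfl fun x _ => ?_
        simp only [ne_eq, Fin.ext_iff, Fin.lt_def]
        rcases lt_trichotomy (x : ℕ) c₁ with h₁ | h₁ | h₁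
        · rw [if_pos (by omega), if_neg (by omega), if_neg (by omega), if_neg (by omega),
            if_neg (by omega), if_pos (by omega), zero_add, zero_add]
        · rw [if_neg (by omega), if_neg (by omega), if_neg (by omega), if_neg (by omega),
            zero_add, zero_add]
        · rcases lt_trichotomy (x : ℕ) c₂ with h₂ | h₂ | h₂
          · rw [if_pos (by omega), if_neg (by omega), if_pos (by omega), if_neg (by omega),
              if_pos (by omega), if_neg (by omega), zero_add, add_zero]
          · rw [if_neg (by omega), if_neg (by omega), if_neg (by omega), if_neg (by omega),
              zero_add, zero_add]
          · rw [if_pos (by omega), if_pos (by omega), if_pos (by omega), if_neg (by omega),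
              if_neg (by omega), add_zero, add_zero]
    · have h₂ : ∀ x, ¬(c₁ < x ∧ x < c₂) := fun x hx => hc (hx.1.trans hx.2)
      simp [hc, h₂]
  rw [Fintype.sum_prod_type]
  simp only [key, Finset.sum_add_distrib]
  have h₂ : (∑ c₁ : Fin (m + 3), ∑ c₂ : Fin (m + 3), ∑ x : Fin (m + 3),
        if c₁ < x ∧ x < c₂ then G c₁ c₂ (m + 1 - x) else 0) =
      ∑ c₁ : Fin (m + 3), ∑ x : Fin (m + 3), ∑ c₂ : Fin (m + 3),
        if c₁ < x ∧ x < c₂ then G c₁ c₂ (m + 1 - x) else 0 :=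
    Finset.sum_congr rfl fun _ _ => Finset.sum_comm
  have h₃ : (∑ c₁ : Fin (m + 3), ∑ c₂ : Fin (m + 3), ∑ x : Fin (m + 3),
        if x < c₁ ∧ c₁ < c₂ then G c₁ c₂ (m - x) else 0) =
      ∑ x : Fin (m + 3), ∑ c₁ : Fin (m + 3), ∑ c₂ : Fin (m + 3),
        if x < c₁ ∧ c₁ < c₂ then G c₁ c₂ (m - x) else 0 := by
    refine Eq.trans (Finset.sum_congr rfl fun _ _ => Finset.sum_comm) ?_
    exact Finset.sum_comm
  rw [h₂, h₃]
  simp only [← Finset.sum_add_distrib]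
  refine Finset.sum_eq_zero fun d₁ _ => Finset.sum_eq_zero fun d₂ _ =>
    Finset.sum_eq_zero fun d₃ _ => ?_
  by_cases h : d₁ < d₂ ∧ d₂ < d₃
  · obtain ⟨h₁₂, h₂₃⟩ := h
    have h₁₂' : (d₁ : ℕ) < d₂ := h₁₂
    have h₂₃' : (d₂ : ℕ) < d₃ := h₂₃
    simp only [h₁₂, h₂₃, and_self, if_true, hG]
    rw [dif_pos (by omega), dif_pos (by omega), dif_pos (by omega)]
    exact hg d₁ d₂ d₃ h₁₂ h₂₃ _ _ _ (by simp only; omega) (by simp only; omega)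
      (by simp only; omega)
  · simp [h]

theorem skipAt_eq_succAbove {m : ℕ} (i : Fin (m + 1)) (t : Fin m) :
    skipAt i t = i.succAbove t := by
  apply Fin.ext
  simp only [skipAt, Fin.succAbove, Fin.lt_def, Fin.val_castSucc]
  split_ifs <;> rfl

section Syzygy

variable (k : Type*) [Field k] {σ : Type*}

theorem quadEl_mem_Iquad (a b : ℕ) {s t s' t' : Fin (a + 1) × Fin (b + 1)}
    (h₁ : (s.1 : ℕ) + t.1 = s'.1 + t'.1) (h₂ : (s.2 : ℕ) + t.2 = s'.2 + t'.2) :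
    quadEl k s t s' t' ∈ Iquad k a b := by
  have := s.1.2; have := s.2.2; have := t.1.2; have := t.2.2
  have := s'.1.2; have := s'.2.2; have := t'.1.2; have := t'.2.2
  simp only [Iquad, quadEl, Submodule.mem_comap, Submodule.subtype_apply, LinearMap.mem_ker,
    AlgHom.toLinearMap_apply, map_sub, map_mul, aeval_X, segVar, mon4, monomial_mul, sub_eq_zero]
  congr 2
  ext i
  fin_cases i <;> simp <;> omega

/-- Cofactor expansion of a `3 × 3` determinant two of whose rows are equal. -/
theorem mulXh_quadEl_expansion (u w : Fin 3 → σ) (ε : Bool) (r : k) :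
    r • mulXh k (if ε then w 2 else u 2) (quadEl k (w 0) (u 1) (u 0) (w 1)) +
      (-r) • mulXh k (if ε then w 1 else u 1) (quadEl k (w 0) (u 2) (u 0) (w 2)) +
      r • mulXh k (if ε then w 0 else u 0) (quadEl k (w 1) (u 2) (u 1) (w 2)) = 0 := by
  apply Subtype.ext
  simp only [mulXh, quadEl, Submodule.coe_add, Submodule.coe_smul, Submodule.coe_zero,
    MvPolynomial.smul_eq_C_mul, map_neg]
  cases ε <;> simp only [if_true, Bool.false_eq_true, if_false] <;> ring

variable [DecidableEq σ]

/-- The `T^j`-coefficient of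
`∑_{c₁ < c₂} ± (⋀_{l ≠ c₁, c₂} (u_l + T w_l)) ⊗ (w_{c₁} u_{c₂} - u_{c₁} w_{c₂})`. -/
def minorSyzygy (p : ℕ) (u w : Fin (p + 1) → σ) (j : ℕ) :
    (⋀[k]^(p - 1) (σ → k)) ⊗[k] (MvPolynomial.homogeneousSubmodule σ k 2) :=
  ∑ e : Fin (p - 1) → Bool, ∑ c : Fin (p + 1) × Fin (p + 1),
    if (c.1 : ℕ) < (c.2 : ℕ) ∧ (∑ t, (if e t then 1 else 0)) = j then
      ((-1 : k) ^ (∑ t : Fin (p - 1), ((desc2 p c.1 c.2 t : ℕ) + 1))) •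
        (wedge k (p - 1) (fun t => Pi.single
            (if e t then w (desc2 p c.1 c.2 t) else u (desc2 p c.1 c.2 t)) 1)
          ⊗ₜ[k] quadEl k (w c.1) (u c.2) (u c.1) (w c.2))
    else 0

theorem alphaEl_eq_minorSyzygy (a b p : ℕ) (P : Fin (p + 1) → Fin (a + 1) × Fin b) (j : ℕ) :
    alphaEl k a b p P j = minorSyzygy k p (fun l => ((P l).1, (P l).2.castSucc))
      (fun l => ((P l).1, (P l).2.succ)) j := by
  simp only [alphaEl, minorSyzygy, apply_ite (Prod.mk _)]

theorem betaEl_eq_minorSyzygy (a b p : ℕ) (Q : Fin (p + 1) → Fin a × Fin (b + 1)) (j : ℕ) :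
    betaEl k a b p Q j = minorSyzygy k p (fun l => ((Q l).1.castSucc, (Q l).2))
      (fun l => ((Q l).1.succ, (Q l).2)) j := by
  have h : ∀ (e : Bool) (l : Fin (p + 1)),
      ((if e then (Q l).1.succ else (Q l).1.castSucc), (Q l).2) =
        if e then ((Q l).1.succ, (Q l).2) else ((Q l).1.castSucc, (Q l).2) := by
    rintro (_ | _) l <;> rfl
  simp only [betaEl, minorSyzygy, h]

theorem minorSyzygy_mem_range (p : ℕ) (u w : Fin (p + 1) → σ) (j : ℕ)
    (I : Submodule k (MvPolynomial.homogeneousSubmodule σ k 2))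
    (hI : ∀ c₁ c₂, quadEl k (w c₁) (u c₂) (u c₁) (w c₂) ∈ I) :
    minorSyzygy k p u w j ∈
      LinearMap.range (LinearMap.lTensor (⋀[k]^(p - 1) (σ → k)) I.subtype) := by
  refine Submodule.sum_mem _ fun e _ => Submodule.sum_mem _ fun c _ => ?_
  split_ifs
  · exact Submodule.smul_mem _ _ ⟨_ ⊗ₜ ⟨_, hI c.1 c.2⟩, rfl⟩
  · exact Submodule.zero_mem _

theorem theta_minorSyzygy (m : ℕ) (u w : Fin (m + 3) → σ) (j : ℕ)
    (θ : ((⋀[k]^(m + 1) (σ → k)) ⊗[k] (MvPolynomial.homogeneousSubmodule σ k 2)) →ₗ[k]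
      ((⋀[k]^m (σ → k)) ⊗[k] (MvPolynomial.homogeneousSubmodule σ k 3)))
    (hθ : ∀ (P : Fin (m + 1) → σ) (q : MvPolynomial.homogeneousSubmodule σ k 2),
      θ (wedge k (m + 1) (fun t => Pi.single (P t) 1) ⊗ₜ[k] q) =
        ∑ i : Fin (m + 1), ((-1 : k) ^ (i : ℕ)) •
          (wedge k m (fun t => Pi.single (P (skipAt i t)) 1) ⊗ₜ[k] mulXh k (P i) q)) :
    θ (minorSyzygy k (m + 2) u w j) = 0 := by
  set pt : Bool → Fin (m + 3) → σ := fun ε l => if ε then w l else u l with hpt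
  set g : Bool → (Fin m → Bool) → Fin (m + 3) → Fin (m + 3) → Fin (m + 1) →
      (⋀[k]^m (σ → k)) ⊗[k] (MvPolynomial.homogeneousSubmodule σ k 3) :=
    fun ε e c₁ c₂ i =>
      ((-1 : k) ^ (∑ t : Fin (m + 1), ((desc2 (m + 2) c₁ c₂ t : ℕ) + 1)) * (-1) ^ (i : ℕ)) •
        (wedge k m (fun t => Pi.single (pt (e t) (desc2 (m + 2) c₁ c₂ (skipAt i t))) 1) ⊗ₜ[k]
          mulXh k (pt ε (desc2 (m + 2) c₁ c₂ i)) (quadEl k (w c₁) (u c₂) (u c₁) (w c₂))) with hg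
  have hsum : θ (minorSyzygy k (m + 2) u w j) = ∑ q : Bool × (Fin m → Bool),
      if (if q.1 then 1 else 0) + (∑ t, (if q.2 t then 1 else 0)) = j then
        ∑ c : Fin (m + 3) × Fin (m + 3), (if c.1 < c.2 then ∑ i, g q.1 q.2 c.1 c.2 i else 0)
      else 0 := by
    have hexpand : θ (minorSyzygy k (m + 2) u w j) =
        ∑ c : Fin (m + 3) × Fin (m + 3), ∑ i : Fin (m + 1), ∑ e : Fin (m + 1) → Bool,
          if c.1 < c.2 ∧ (∑ t, (if e t then 1 else 0)) = j then
            g (e i) (fun t => e (skipAt i t)) c.1 c.2 i else 0 := by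
      rw [minorSyzygy, Finset.sum_comm, map_sum]
      refine Finset.sum_congr rfl fun c _ => ?_
      rw [Finset.sum_comm, map_sum]
      refine Finset.sum_congr rfl fun e _ => ?_
      by_cases hc : c.1 < c.2 ∧ (∑ t : Fin (m + 1), (if e t then 1 else 0)) = j
      · refine (congrArg θ (if_pos hc)).trans ((map_smul θ _ _).trans ?_)
        simp only [if_pos hc, hg, mul_smul, ← Finset.smul_sum]
        congr 1
        exact hθ (fun t => pt (e t) (desc2 (m + 2) c.1 c.2 t)) _
      · refine (congrArg θ (if_neg hc)).trans ((map_zero θ).trans ?_)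
        simp only [if_neg hc, Finset.sum_const_zero]
    have hsplit : ∀ (c : Fin (m + 3) × Fin (m + 3)) (i : Fin (m + 1)),
        (∑ e : Fin (m + 1) → Bool, if c.1 < c.2 ∧ (∑ t, (if e t then 1 else 0)) = j then
            g (e i) (fun t => e (skipAt i t)) c.1 c.2 i else 0) =
        ∑ q : Bool × (Fin m → Bool),
          if (if q.1 then 1 else 0) + (∑ t, (if q.2 t then 1 else 0)) = j then
            (if c.1 < c.2 then g q.1 q.2 c.1 c.2 i else 0) else 0 := by
      intro c i
      rw [← (Fin.insertNthEquiv (fun _ => Bool) i).sum_comp]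
      refine Finset.sum_congr rfl fun q _ => ?_
      simp only [Fin.insertNthEquiv_apply, Fin.sum_univ_succAbove _ i, Fin.insertNth_apply_same,
        Fin.insertNth_apply_succAbove, skipAt_eq_succAbove, ← ite_and, and_comm]
    simp only [hexpand, hsplit]
    rw [Finset.sum_congr rfl fun c _ => Finset.sum_comm, Finset.sum_comm]
    refine Finset.sum_congr rfl fun q _ => ?_
    by_cases hq : (if q.1 then 1 else 0) + (∑ t, (if q.2 t then 1 else 0)) = j
    · simp only [if_pos hq]
      refine Finset.sum_congr rfl fun c _ => ?_
      by_cases hc : c.1 < c.2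
      · simp only [if_pos hc]
      · simp only [if_neg hc, Finset.sum_const_zero]
    · simp only [if_neg hq, Finset.sum_const_zero]
  rw [hsum]
  refine Finset.sum_eq_zero fun ⟨ε, e⟩ _ => ite_eq_right_iff.mpr fun _ => ?_
  refine sum_pair_desc2_eq_zero m (g ε e) fun d₁ d₂ d₃ h₁₂ h₂₃ i₁ i₂ i₃ hi₃ hi₂ hi₁ => ?_
  have h₁₂' : (d₁ : ℕ) < d₂ := h₁₂
  have h₂₃' : (d₂ : ℕ) < d₃ := h₂₃
  have hx₃ : desc2 (m + 2) d₁ d₂ i₃ = d₃ := by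
    simp only [desc2, Fin.ext_iff]; split_ifs <;> omega
  have hx₂ : desc2 (m + 2) d₁ d₃ i₂ = d₂ := by
    simp only [desc2, Fin.ext_iff]; split_ifs <;> omega
  have hx₁ : desc2 (m + 2) d₂ d₃ i₁ = d₁ := by
    simp only [desc2, Fin.ext_iff]; split_ifs <;> omega
  have hr₂ : ∀ t : Fin m, desc2 (m + 2) d₁ d₃ (skipAt i₂ t) =
      desc2 (m + 2) d₁ d₂ (skipAt i₃ t) := by
    intro t
    have := t.2
    simp only [desc2, skipAt, Fin.ext_iff]; split_ifs <;> omega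
  have hr₁ : ∀ t : Fin m, desc2 (m + 2) d₂ d₃ (skipAt i₁ t) =
      desc2 (m + 2) d₁ d₂ (skipAt i₃ t) := by
    intro t
    have := t.2
    simp only [desc2, skipAt, Fin.ext_iff]; split_ifs <;> omega
  simp only [hg, hx₁, hx₂, hx₃, hr₁, hr₂, neg_one_pow_sum_desc2 m h₁₂,
    neg_one_pow_sum_desc2 m h₂₃, neg_one_pow_sum_desc2 m (h₁₂.trans h₂₃)]
  set r : k := (-1 : k) ^ (∑ x : Fin (m + 3), ((x : ℕ) + 1))
  have hs : ∀ n n' : ℕ, n % 2 = n' % 2 → (-1 : k) ^ n = (-1) ^ n' := by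
    intro n n' h
    rw [← Nat.div_add_mod n 2, ← Nat.div_add_mod n' 2, h, pow_add, pow_add, pow_mul, pow_mul]
    simp
  have hs₃ : r * (-1) ^ ((d₁ : ℕ) + d₂) * (-1) ^ (i₃ : ℕ) =
      r * (-1) ^ ((d₁ : ℕ) + d₂ + d₃ + m) := by
    rw [mul_assoc, ← pow_add, hs _ ((d₁ : ℕ) + d₂ + d₃ + m) (by omega)]
  have hs₂ : r * (-1) ^ ((d₁ : ℕ) + d₃) * (-1) ^ (i₂ : ℕ) =
      -(r * (-1) ^ ((d₁ : ℕ) + d₂ + d₃ + m)) := by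
    rw [mul_assoc, ← pow_add, hs _ ((d₁ : ℕ) + d₂ + d₃ + m + 1) (by omega), pow_succ]
    ring
  have hs₁ : r * (-1) ^ ((d₂ : ℕ) + d₃) * (-1) ^ (i₁ : ℕ) =
      r * (-1) ^ ((d₁ : ℕ) + d₂ + d₃ + m) := by
    rw [mul_assoc, ← pow_add, hs _ ((d₁ : ℕ) + d₂ + d₃ + m) (by omega)]
  rw [hs₁, hs₂, hs₃, ← TensorProduct.tmul_smul, ← TensorProduct.tmul_smul,
    ← TensorProduct.tmul_smul, ← TensorProduct.tmul_add, ← TensorProduct.tmul_add]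
  have h := mulXh_quadEl_expansion k (u ∘ ![d₁, d₂, d₃]) (w ∘ ![d₁, d₂, d₃]) ε
    (r * (-1) ^ ((d₁ : ℕ) + d₂ + d₃ + m))
  simp only [Function.comp_apply, Matrix.cons_val] at h
  simp only [hpt]
  rw [h, TensorProduct.tmul_zero]

end Syzygy

/-- With `3 ≤ a ≤ b`, `p = ab + a − 1`, and `V` identified with `R_1` by
`v_{(i,j)} ↦ x^i y^{a−i} z^j w^{b−j}` (so that `I := ker(S²V → R_2)` is the space of
quadrics of the Segre–Veronese embedding): every element `α_{S,j}` and every element `β_j`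
lies in `Λ^{p−1}V ⊗ I` (i.e. in the image of `Λ^{p−1}V ⊗ I → Λ^{p−1}V ⊗ S²V`) and is
mapped to zero by the Koszul-type map `θ : Λ^{p−1}V ⊗ S²V → Λ^{p−2}V ⊗ S³V`,
`v_1∧⋯∧v_{p−1} ⊗ q ↦ Σ_i (−1)^{i+1} v_1∧⋯∧v̂_i∧⋯∧v_{p−1} ⊗ v_i·q`. -/
theorem alpha_beta_mem_and_theta_eq_zero (k : Type*) [Field k] (a b : ℕ)
    (ha : 3 ≤ a) (hab : a ≤ b) (p : ℕ) (hp : p = a * b + a - 1)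
    (ord : Finset (Fin (a + 1) × Fin b) → Fin (p + 1) → Fin (a + 1) × Fin b)
    (hord : ∀ S : Finset (Fin (a + 1) × Fin b), S.card = p + 1 →
      Function.Injective (ord S) ∧ ∀ t, ord S t ∈ S)
    (Q : Fin (p + 1) → Fin a × Fin (b + 1)) (hQ : Function.Bijective Q)
    (θ : ((⋀[k]^(p-1) ((Fin (a + 1) × Fin (b + 1)) → k)) ⊗[k]
        (MvPolynomial.homogeneousSubmodule (Fin (a + 1) × Fin (b + 1)) k 2)) →ₗ[k]
      ((⋀[k]^(p-2) ((Fin (a + 1) × Fin (b + 1)) → k)) ⊗[k]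
        (MvPolynomial.homogeneousSubmodule (Fin (a + 1) × Fin (b + 1)) k 3)))
    (hθ : ∀ (P : Fin (p - 1) → Fin (a + 1) × Fin (b + 1))
        (q : MvPolynomial.homogeneousSubmodule (Fin (a + 1) × Fin (b + 1)) k 2),
      θ (wedge k (p - 1) (fun t => Pi.single (P t) 1) ⊗ₜ[k] q) =
        ∑ i : Fin (p - 1), ((-1 : k) ^ (i : ℕ)) •
          (wedge k (p - 2) (fun t => Pi.single (P (skipAt i t)) 1) ⊗ₜ[k] mulXh k (P i) q)) :
    (∀ (S : Finset (Fin (a + 1) × Fin b)) (_ : S.card = p + 1) (j : Fin p),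
      alphaEl k a b p (ord S) (j : ℕ) ∈
        LinearMap.range (LinearMap.lTensor (⋀[k]^(p-1) ((Fin (a + 1) × Fin (b + 1)) → k))
          (Iquad k a b).subtype) ∧
      θ (alphaEl k a b p (ord S) (j : ℕ)) = 0) ∧
    (∀ j : Fin p,
      betaEl k a b p Q (j : ℕ) ∈
        LinearMap.range (LinearMap.lTensor (⋀[k]^(p-1) ((Fin (a + 1) × Fin (b + 1)) → k))
          (Iquad k a b).subtype) ∧
      θ (betaEl k a b p Q (j : ℕ)) = 0) := by
  obtain ⟨m, rfl⟩ : ∃ m, p = m + 2 := by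
    have : 3 * 3 ≤ a * b := Nat.mul_le_mul ha (ha.trans hab)
    exact ⟨p - 2, by omega⟩
  refine ⟨fun S _ j => ?_, fun j => ?_⟩
  · rw [alphaEl_eq_minorSyzygy]
    refine ⟨minorSyzygy_mem_range k _ _ _ _ _ fun c₁ c₂ => quadEl_mem_Iquad k a b rfl ?_,
      theta_minorSyzygy k m _ _ _ θ hθ⟩
    simp only [Fin.val_succ, Fin.val_castSucc]
    omega
  · rw [betaEl_eq_minorSyzygy]
    refine ⟨minorSyzygy_mem_range k _ _ _ _ _ fun c₁ c₂ => quadEl_mem_Iquad k a b ?_ rfl,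
      theta_minorSyzygy k m _ _ _ θ hθ⟩
    simp only [Fin.val_succ, Fin.val_castSucc]
    omega

end
end
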